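/- arXiv:1409.6028 — 4 statements merged into one kernel-verified Lean document; each statement's English description precedes it below -/
import Mathlib

section
/- Let X and Y be real Banach spaces, let L⁻¹ : Y → X be a bounded linear operator, and let Q : [0,∞) → 𝓛(Y) be a family of bounded linear operators such that ‖Q(t)‖ ≤ M₀ for all t ≥ 0 and t ↦ Q(t)u is continuous for each u ∈ Y. Fix 0 < α < 1 and define S_α(t)u = ∫₀^∞ ζ_α(θ) L⁻¹ Q(t^α θ) u dθ and T_α(t)u = α ∫₀^∞ θ ζ_α(θ) L⁻¹ Q(t^α θ) u dθ. Then S_α and T_α are strongly continuous: for every u ∈ Y, the maps t ↦ S_α(t)u and t ↦ T_α(t)u are continuous from [0,∞) to X; in particular, for 0 ≤ t₁ < t₂, ‖S_α(t₂)u − S_α(t₁)u‖ → 0 and ‖T_α(t₂)u − T_α(t₁)u‖ → 0 as t₁ → t₂. -/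
open MeasureTheory

/-- The Wright-type function `ϖ_α(θ)` for `0 < α < 1`. -/
noncomputable def wrightFn (α θ : ℝ) : ℝ :=
  (1 / Real.pi) * ∑' n : ℕ,
    (-1 : ℝ) ^ n * θ ^ (-(α * ((n : ℝ) + 1)) - 1) *
      (Real.Gamma (((n : ℝ) + 1) * α + 1) / (Nat.factorial (n + 1) : ℝ)) *
      Real.sin (((n : ℝ) + 1) * Real.pi * α)

/-- The probability density `ζ_α(θ) = (1/α) θ^{-1-1/α} ϖ_α(θ^{-1/α})`. -/
noncomputable def zetaFn (α θ : ℝ) : ℝ :=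
  (1 / α) * θ ^ (-1 - 1 / α) * wrightFn α (θ ^ (-(1 / α)))

lemma aux_gamma_hasDeriv (a : ℝ) (ha : 0 < a) (z : ℂ) (hz : 0 < z.re) :
    DifferentiableAt ℂ (fun z : ℂ => ∫ r in Set.Ioi (0:ℝ), ((r ^ (a-1) : ℝ) : ℂ) * Complex.exp (-(z * r))) z := by
  have key : ∀ b : ℝ, -1 < b → ∀ c : ℝ, 0 < c →
      IntegrableOn (fun r : ℝ => r ^ b * Real.exp (-(c * r))) (Set.Ioi 0) := by
    intro b hb c hc
    have := integrableOn_rpow_mul_exp_neg_mul_rpow (p := 1) (s := b) (b := c) hb one_pos hc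
    simpa using this
  have hm : ∀ (b : ℝ) (w : ℂ), AEStronglyMeasurable (fun r : ℝ => ((r ^ b : ℝ) : ℂ) * Complex.exp (-(w * r)))
      (volume.restrict (Set.Ioi 0)) := by
    intro b w
    apply Measurable.aestronglyMeasurable
    fun_prop
  have hnorm : ∀ (b : ℝ) (w : ℂ) (r : ℝ), 0 < r →
      ‖((r ^ b : ℝ) : ℂ) * Complex.exp (-(w * r))‖ = r ^ b * Real.exp (-(w.re * r)) := by
    intro b w r hr
    rw [norm_mul, Complex.norm_exp, Complex.norm_real, Real.norm_of_nonneg (by positivity)]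
    simp
  have hs : {w : ℂ | z.re / 2 < w.re} ∈ nhds z :=
    (isOpen_lt continuous_const Complex.continuous_re).mem_nhds (by simp; linarith)
  refine (hasDerivAt_integral_of_dominated_loc_of_deriv_le
    (F' := fun w r => -(((r ^ a : ℝ) : ℂ) * Complex.exp (-(w * r)))) (bound := fun r => r ^ a * Real.exp (-(z.re/2 * r)))
    hs (Filter.Eventually.of_forall fun w => hm _ w) ?_ (hm a z).neg ?_ ?_ ?_).2.differentiableAt
  · refine (key (a-1) (by linarith) z.re hz).mono' (hm _ _) ?_
    filter_upwards [ae_restrict_mem measurableSet_Ioi] with r hr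
    exact (hnorm _ _ _ hr).le
  · filter_upwards [ae_restrict_mem measurableSet_Ioi] with r hr w hw
    have hr : 0 < r := hr
    rw [norm_neg, hnorm _ _ _ hr]
    have hw : z.re / 2 < w.re := hw
    gcongr
  · exact key a (by linarith) _ (by linarith)
  · filter_upwards [ae_restrict_mem measurableSet_Ioi] with r hr w hw
    have hr : 0 < r := hr
    have h1 : HasDerivAt (fun w : ℂ => -(w * r)) (-(1 * (r:ℂ))) w := ((hasDerivAt_id w).mul_const (r:ℂ)).neg
    have h2 := (h1.cexp).const_mul (((r ^ (a-1) : ℝ) : ℂ))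
    refine h2.congr_deriv ?_
    have : r ^ a = r ^ (a-1) * r := by
      rw [← Real.rpow_add_one hr.ne']; simp
    rw [this]; push_cast; ring

lemma aux_gamma (a : ℝ) (ha : 0 < a) (z : ℂ) (hz : 0 < z.re) :
    ∫ r in Set.Ioi (0:ℝ), ((r ^ (a-1) : ℝ) : ℂ) * Complex.exp (-(z * r))
      = (Real.Gamma a : ℂ) * z ^ (-(a:ℂ)) := by
  have ho : IsOpen {w : ℂ | 0 < w.re} := isOpen_lt continuous_const Complex.continuous_re
  have h1 : DifferentiableOn ℂ (fun z : ℂ => ∫ r in Set.Ioi (0:ℝ), ((r ^ (a-1) : ℝ) : ℂ) * Complex.exp (-(z * r))) {w : ℂ | 0 < w.re} :=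
    fun w hw => (aux_gamma_hasDeriv a ha w hw).differentiableWithinAt
  have h2 : DifferentiableOn ℂ (fun z : ℂ => (Real.Gamma a : ℂ) * z ^ (-(a:ℂ))) {w : ℂ | 0 < w.re} := by
    intro w hw
    apply DifferentiableAt.differentiableWithinAt
    apply DifferentiableAt.const_mul
    exact DifferentiableAt.cpow_const differentiableAt_id (Or.inl hw)
  have hpre : IsPreconnected {w : ℂ | 0 < w.re} := (convex_halfSpace_re_gt 0).isPreconnected
  refine (h1.analyticOnNhd ho).eqOn_of_preconnected_of_frequently_eq (h2.analyticOnNhd ho) hpre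
    (z₀ := 1) (by simp) ?_ hz
  have ht : Filter.Tendsto (fun x : ℝ => (x : ℂ)) (nhdsWithin 1 {1}ᶜ) (nhdsWithin 1 {1}ᶜ) := by
    apply tendsto_nhdsWithin_of_tendsto_nhds_of_eventually_within
    · have : Filter.Tendsto (fun x : ℝ => (x : ℂ)) (nhds 1) (nhds ((1:ℝ):ℂ)) := Complex.continuous_ofReal.tendsto 1
      simpa using this.mono_left nhdsWithin_le_nhds
    · filter_upwards [self_mem_nhdsWithin] with x hx
      simpa using hx
  refine ht.frequently (Filter.Eventually.frequently ?_)
  have : ∀ᶠ x : ℝ in nhdsWithin 1 {1}ᶜ, 0 < x := nhdsWithin_le_nhds (lt_mem_nhds one_pos)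
  filter_upwards [this] with x hx
  have h3 := Real.integral_rpow_mul_exp_neg_mul_Ioi ha hx
  have h4 : ∫ r in Set.Ioi (0:ℝ), ((r ^ (a-1) : ℝ) : ℂ) * Complex.exp (-(x * r)) =
     ((∫ r in Set.Ioi (0:ℝ), r ^ (a-1) * Real.exp (-(x * r)) : ℝ) : ℂ) := by
    rw [← integral_complex_ofReal]
    congr 1; ext r; push_cast; rfl
  rw [h4, h3, one_div, Real.inv_rpow hx.le, ← Real.rpow_neg hx.le]
  push_cast
  rw [Complex.ofReal_cpow hx.le]; push_cast; ring

lemma aux_young (α θ c : ℝ) (hα0 : 0 < α) (hα1 : α < 1) (hθ : 0 < θ) (hc : 0 < c) :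
    ∃ C : ℝ, ∀ r : ℝ, 0 < r → θ * r ^ α ≤ c * r + C := by
  set R : ℝ := (θ / c) ^ (1 / (1 - α)) with hR
  have hRpos : 0 < R := by positivity
  refine ⟨θ * R ^ α, fun r hr => ?_⟩
  rcases le_total r R with h | h
  · have : r ^ α ≤ R ^ α := Real.rpow_le_rpow hr.le h hα0.le
    nlinarith [mul_pos hc hr]
  · have h1 : R ^ (1 - α) ≤ r ^ (1 - α) := Real.rpow_le_rpow hRpos.le h (by linarith)
    have h2 : R ^ (1 - α) = θ / c := by
      rw [hR, ← Real.rpow_mul (by positivity), one_div_mul_cancel (by linarith), Real.rpow_one]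
    rw [h2, div_le_iff₀ hc] at h1
    have h3 : r ^ (1 - α) * r ^ α = r := by
      rw [← Real.rpow_add hr]; simp
    have h4 : 0 < r ^ α := by positivity
    have h5 : 0 < θ * R ^ α := by positivity
    nlinarith

lemma aux_int (α θ c : ℝ) (hα0 : 0 < α) (hα1 : α < 1) (hθ : 0 < θ) (hc : 0 < c) :
    IntegrableOn (fun r : ℝ => Real.exp (-(c * r)) * Real.exp (θ * r ^ α)) (Set.Ioi 0) := by
  obtain ⟨C, hC⟩ := aux_young α θ (c/2) hα0 hα1 hθ (by linarith)
  have h1 : IntegrableOn (fun r : ℝ => Real.exp C * Real.exp (-(c/2) * r)) (Set.Ioi 0) :=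
    (exp_neg_integrableOn_Ioi 0 (by linarith : 0 < c/2)).const_mul _
  refine h1.mono' (Measurable.aestronglyMeasurable (by fun_prop)) ?_
  filter_upwards [ae_restrict_mem measurableSet_Ioi] with r hr
  have := hC r hr
  rw [Real.norm_of_nonneg (by positivity), ← Real.exp_add, ← Real.exp_add]
  apply Real.exp_le_exp.mpr
  linarith

noncomputable def auxz (α : ℝ) : ℂ := Complex.exp (-((α * Real.pi / 2 : ℝ) : ℂ) * Complex.I)
noncomputable def auxw (α : ℝ) : ℂ := Complex.exp (((α * (Real.pi - α * Real.pi / 2) : ℝ) : ℂ) * Complex.I)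

lemma auxz_norm (α : ℝ) : ‖auxz α‖ = 1 := by
  have := Complex.norm_exp_ofReal_mul_I (-(α * Real.pi / 2))
  simpa [auxz] using this
lemma auxw_norm (α : ℝ) : ‖auxw α‖ = 1 := Complex.norm_exp_ofReal_mul_I _
lemma auxz_re (α : ℝ) (hα0 : 0 < α) (hα1 : α < 1) : 0 < (auxz α).re := by
  have : (auxz α).re = Real.cos (-(α * Real.pi / 2)) := by
    rw [auxz, ← Complex.exp_ofReal_mul_I_re]; push_cast; rfl
  rw [this]
  apply Real.cos_pos_of_mem_Ioo
  constructor <;> nlinarith [Real.pi_pos]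
lemma auxw_re (α : ℝ) (hα0 : 0 < α) (hα1 : α < 1) : 0 < (auxw α).re := by
  rw [auxw, Complex.exp_ofReal_mul_I_re]
  apply Real.cos_pos_of_mem_Ioo
  have := Real.pi_pos
  constructor
  · have : 0 < α * (Real.pi - α * Real.pi / 2) := by
      apply mul_pos hα0; nlinarith
    linarith
  · have : 0 < Real.pi * (1 - α)^2 := mul_pos Real.pi_pos (by apply pow_pos; linarith)
    nlinarith

noncomputable def auxG (α θ : ℝ) : ℂ :=
  ∫ r in Set.Ioi (0:ℝ), Complex.exp (-(auxz α * r)) * Complex.exp (-(θ * (r ^ α : ℝ) * auxw α))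

lemma aux_term (α θ : ℝ) (hα0 : 0 < α) (hα1 : α < 1) (k : ℕ) :
    auxz α * ∫ r in Set.Ioi (0:ℝ), Complex.exp (-(auxz α * r)) * ((-(θ * (r ^ α : ℝ) * auxw α)) ^ k / (k.factorial : ℂ))
    = (((-θ) ^ k * (Real.Gamma (k * α + 1) / (k.factorial : ℝ)) : ℝ) : ℂ) * Complex.exp ((k * Real.pi * α : ℝ) * Complex.I) := by
  have h1 : ∫ r in Set.Ioi (0:ℝ), Complex.exp (-(auxz α * r)) * ((-(θ * (r ^ α : ℝ) * auxw α)) ^ k / (k.factorial : ℂ))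
    = ∫ r in Set.Ioi (0:ℝ), ((-θ : ℂ) ^ k * auxw α ^ k / (k.factorial : ℂ)) * (((r ^ ((k * α + 1 : ℝ) - 1) : ℝ) : ℂ) * Complex.exp (-(auxz α * r))) := by
    apply setIntegral_congr_fun measurableSet_Ioi
    intro r hr
    have hr : 0 < r := hr
    have : r ^ ((k * α + 1 : ℝ) - 1) = (r ^ α) ^ k := by
      rw [← Real.rpow_natCast, ← Real.rpow_mul hr.le]; congr 1; ring
    simp only [this]
    push_cast
    rw [show -((θ:ℂ) * ((r ^ α : ℝ) : ℂ) * auxw α) = (-θ : ℂ) * auxw α * ((r ^ α : ℝ) : ℂ) by ring, mul_pow, mul_pow]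
    ring
  rw [h1, integral_const_mul, aux_gamma _ (by positivity) _ (auxz_re α hα0 hα1)]
  have hz : auxz α ^ (-((k * α + 1 : ℝ) : ℂ)) = Complex.exp (((α * Real.pi / 2 : ℝ) : ℂ) * Complex.I * (k * α + 1)) := by
    rw [Complex.cpow_def_of_ne_zero (show auxz α ≠ 0 from Complex.exp_ne_zero _)]
    have : Complex.log (auxz α) = -((α * Real.pi / 2 : ℝ) : ℂ) * Complex.I := by
      rw [auxz, Complex.log_exp]
      · simp; nlinarith [Real.pi_pos]
      · simp; nlinarith [Real.pi_pos]
    rw [this]; congr 1; push_cast; ring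
  rw [hz]
  have : auxz α * auxw α ^ k * Complex.exp (((α * Real.pi / 2 : ℝ) : ℂ) * Complex.I * (k * α + 1)) =
     Complex.exp ((k * Real.pi * α : ℝ) * Complex.I) := by
    rw [auxz, auxw, ← Complex.exp_nat_mul, ← Complex.exp_add, ← Complex.exp_add]
    congr 1; push_cast; ring
  rw [← this]; push_cast; ring

lemma aux_hasSum (α θ : ℝ) (hα0 : 0 < α) (hα1 : α < 1) (hθ : 0 < θ) :
    HasSum (fun k : ℕ => (((-θ) ^ k * (Real.Gamma (k * α + 1) / (k.factorial : ℝ)) : ℝ) : ℂ) * Complex.exp ((k * Real.pi * α : ℝ) * Complex.I))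
      (auxz α * auxG α θ) := by
  simp_rw [← aux_term α θ hα0 hα1]
  apply HasSum.mul_left
  have hb : ∀ r : ℝ, HasSum (fun k : ℕ => Real.exp (-((auxz α).re * r)) * ((θ * r ^ α) ^ k / (k.factorial : ℝ)))
      (Real.exp (-((auxz α).re * r)) * Real.exp (θ * r ^ α)) := by
    intro r
    apply HasSum.mul_left
    rw [Real.exp_eq_exp_ℝ]
    exact NormedSpace.expSeries_div_hasSum_exp _
  refine hasSum_integral_of_dominated_convergence
    (fun (k : ℕ) (r : ℝ) => Real.exp (-((auxz α).re * r)) * ((θ * r ^ α) ^ k / (k.factorial : ℝ))) ?_ ?_ ?_ ?_ ?_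
  · intro k
    exact Measurable.aestronglyMeasurable (by fun_prop)
  · intro k
    filter_upwards [ae_restrict_mem measurableSet_Ioi] with r hr
    have hr : 0 < r := hr
    rw [norm_mul, norm_div, norm_pow, norm_neg, norm_mul, norm_mul, auxw_norm, Complex.norm_exp,
      Complex.norm_real, Complex.norm_real, Real.norm_of_nonneg hθ.le, Real.norm_of_nonneg (by positivity)]
    simp
  · exact Filter.Eventually.of_forall fun r => (hb r).summable
  · simp_rw [fun r => (hb r).tsum_eq]
    exact aux_int α θ _ hα0 hα1 hθ (auxz_re α hα0 hα1)
  · refine Filter.Eventually.of_forall fun r => ?_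
    apply HasSum.mul_left
    rw [Complex.exp_eq_exp_ℂ]
    exact NormedSpace.expSeries_div_hasSum_exp _

/-- Integral representation. -/
lemma zetaFn_eq (α θ : ℝ) (hα0 : 0 < α) (hα1 : α < 1) (hθ : 0 < θ) :
    zetaFn α θ = -(1 / (α * Real.pi)) * θ⁻¹ * (auxz α * auxG α θ).im := by
  have h := Complex.hasSum_im (aux_hasSum α θ hα0 hα1 hθ)
  have h2 := (hasSum_nat_add_iff' 1).mpr h
  have e : ∀ (x y : ℝ), ((x : ℂ) * Complex.exp ((y : ℝ) * Complex.I)).im = x * Real.sin y := by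
    intro x y
    rw [Complex.im_ofReal_mul, Complex.exp_ofReal_mul_I_im]
  simp only [e] at h2
  simp only [Finset.range_one, Finset.sum_singleton] at h2
  have h3 := h2.tsum_eq
  simp only [Nat.cast_zero, zero_mul, Real.sin_zero, mul_zero, sub_zero] at h3
  rw [zetaFn, wrightFn, ← h3, ← tsum_mul_left, ← tsum_mul_left, ← tsum_mul_left]
  congr 1
  ext n
  have hp : θ ^ (-1 - 1 / α) * (θ ^ (-(1 / α))) ^ (-(α * ((n : ℝ) + 1)) - 1) = θ⁻¹ * θ ^ (n + 1) := by
    rw [← Real.rpow_mul hθ.le, ← Real.rpow_add hθ, pow_succ', inv_mul_cancel_left₀ hθ.ne', ← Real.rpow_natCast]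
    congr 1
    field_simp
    ring
  have hs : (-θ) ^ (n + 1) = - ((-1) ^ n * θ ^ (n+1)) := by
    rw [neg_pow, pow_succ]; ring
  rw [hs]
  push_cast
  set g := Real.Gamma (((n : ℝ) + 1) * α + 1) / (Nat.factorial (n + 1) : ℝ)
  set q := Real.sin (((n : ℝ) + 1) * Real.pi * α)
  calc _ = 1 / α * (1 / Real.pi) * (-1) ^ n * (θ ^ (-1 - 1 / α) * (θ ^ (-(1 / α))) ^ (-(α * ((n : ℝ) + 1)) - 1)) * g * q := by ring
    _ = _ := by
      rw [hp, one_div, one_div, one_div, mul_inv]; ring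

lemma aux_intA (α θ : ℝ) (hα0 : 0 < α) (hα1 : α < 1) (hθ : 0 < θ) :
    ‖auxG α θ‖ ≤ (θ * (auxw α).re) ^ (-1 / α) * Real.Gamma (1 / α + 1) := by
  have hw := auxw_re α hα0 hα1
  have hz := auxz_re α hα0 hα1
  have hd : 0 < θ * (auxw α).re := by positivity
  rw [← integral_exp_neg_mul_rpow hα0 hd]
  have hi := integrableOn_rpow_mul_exp_neg_mul_rpow (p := α) (s := 0) (b := θ * (auxw α).re) (by norm_num) hα0 hd
  simp only [Real.rpow_zero, one_mul] at hi
  refine norm_integral_le_of_norm_le hi ?_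
  filter_upwards [ae_restrict_mem measurableSet_Ioi] with r hr
  have hr : 0 < r := hr
  rw [norm_mul, Complex.norm_exp, Complex.norm_exp, ← Real.exp_add]
  apply Real.exp_le_exp.mpr
  have h1 : (-(auxz α * (r:ℂ))).re = -((auxz α).re * r) := by simp
  have h2 : (-((θ:ℂ) * ((r ^ α : ℝ) : ℂ) * auxw α)).re = -(θ * r ^ α * (auxw α).re) := by
    rw [← Complex.ofReal_mul, Complex.neg_re, Complex.re_ofReal_mul]
  rw [h1, h2]
  nlinarith [mul_pos hz hr]

lemma aux_exp_sub (x : ℂ) (hx : x.re ≤ 0) : ‖Complex.exp x - 1‖ ≤ 2 * ‖x‖ := by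
  rcases le_total ‖x‖ 1 with h | h
  · exact Complex.norm_exp_sub_one_le h
  · have h1 : ‖Complex.exp x‖ ≤ 1 := by
      rw [Complex.norm_exp]; exact Real.exp_le_one_iff.mpr hx
    have := norm_sub_le (Complex.exp x) 1
    simp only [norm_one] at this
    linarith

lemma aux_intB (α θ : ℝ) (hα0 : 0 < α) (hα1 : α < 1) (hθ : 0 < θ) :
    ‖auxz α * auxG α θ - 1‖ ≤
      2 * θ * ∫ r in Set.Ioi (0:ℝ), r ^ α * Real.exp (-(auxz α).re * r ^ (1:ℝ)) := by
  have hw := auxw_re α hα0 hα1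
  have hz := auxz_re α hα0 hα1
  have h1 := aux_gamma 1 one_pos (auxz α) hz
  have hz0 : auxz α ≠ 0 := Complex.exp_ne_zero _
  simp only [sub_self, Real.rpow_zero, Complex.ofReal_one, one_mul, Real.Gamma_one, Complex.cpow_neg_one] at h1
  have h2 : (1:ℂ) = auxz α * ∫ r in Set.Ioi (0:ℝ), Complex.exp (-(auxz α * r)) := by
    rw [h1, mul_inv_cancel₀ hz0]
  have hre : ∀ r : ℝ, (-((θ:ℂ) * ((r ^ α : ℝ) : ℂ) * auxw α)).re = -(θ * r ^ α * (auxw α).re) := by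
    intro r
    rw [← Complex.ofReal_mul, Complex.neg_re, Complex.re_ofReal_mul]
  have hre1 : ∀ r : ℝ, (-(auxz α * (r:ℂ))).re = -((auxz α).re * r) := by intro r; simp
  have i1 : IntegrableOn (fun r : ℝ => Complex.exp (-(auxz α * r))) (Set.Ioi 0) := by
    refine (exp_neg_integrableOn_Ioi 0 hz).mono' (Measurable.aestronglyMeasurable (by fun_prop)) ?_
    filter_upwards with r
    rw [Complex.norm_exp, hre1, neg_mul]
  have i2 : IntegrableOn (fun r : ℝ => Complex.exp (-(auxz α * r)) * Complex.exp (-(θ * (r ^ α : ℝ) * auxw α))) (Set.Ioi 0) := by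
    refine (exp_neg_integrableOn_Ioi 0 hz).mono' (Measurable.aestronglyMeasurable (by fun_prop)) ?_
    filter_upwards [ae_restrict_mem measurableSet_Ioi] with r hr
    have hr : 0 < r := hr
    rw [norm_mul, Complex.norm_exp, Complex.norm_exp, hre, hre1, ← Real.exp_add]
    apply Real.exp_le_exp.mpr
    have : 0 < θ * r ^ α * (auxw α).re := by positivity
    linarith
  rw [h2]
  rw [← mul_sub, auxG, ← integral_sub i2 i1, norm_mul, auxz_norm, one_mul, ← integral_const_mul]
  refine norm_integral_le_of_norm_le ?_ ?_
  · exact (integrableOn_rpow_mul_exp_neg_mul_rpow (by linarith) one_pos hz).const_mul _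
  · filter_upwards [ae_restrict_mem measurableSet_Ioi] with r hr
    have hr : 0 < r := hr
    have hle : (-((θ:ℂ) * ((r ^ α : ℝ) : ℂ) * auxw α)).re ≤ 0 := by
      rw [hre]
      have : 0 < θ * r ^ α * (auxw α).re := by positivity
      linarith
    have hb := aux_exp_sub _ hle
    have hn : ‖-((θ:ℂ) * ((r ^ α : ℝ) : ℂ) * auxw α)‖ = θ * r ^ α := by
      rw [norm_neg, norm_mul, norm_mul, auxw_norm, Complex.norm_real, Complex.norm_real,
        Real.norm_of_nonneg hθ.le, Real.norm_of_nonneg (by positivity), mul_one]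
    rw [hn] at hb
    rw [← mul_sub_one, norm_mul, Complex.norm_exp, hre1, Real.rpow_one, neg_mul]
    have := mul_le_mul_of_nonneg_left hb (Real.exp_pos (-((auxz α).re * r))).le
    linarith

lemma zetaFn_meas (α : ℝ) (hα0 : 0 < α) (hα1 : α < 1) :
    AEStronglyMeasurable (zetaFn α) (volume.restrict (Set.Ioi 0)) := by
  have h1 : StronglyMeasurable (auxG α) := by
    refine StronglyMeasurable.integral_prod_right (f := fun (θ r : ℝ) =>
      Complex.exp (-(auxz α * r)) * Complex.exp (-(θ * (r ^ α : ℝ) * auxw α))) ?_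
    apply Measurable.stronglyMeasurable
    unfold Function.uncurry
    fun_prop
  have h2 : Measurable (auxG α) := h1.measurable
  have h3 : AEStronglyMeasurable (fun θ : ℝ => -(1 / (α * Real.pi)) * θ⁻¹ * (auxz α * auxG α θ).im)
      (volume.restrict (Set.Ioi 0)) := by
    apply Measurable.aestronglyMeasurable
    fun_prop
  refine h3.congr ?_
  filter_upwards [ae_restrict_mem measurableSet_Ioi] with θ hθ
  exact (zetaFn_eq α θ hα0 hα1 hθ).symm

lemma zetaFn_bounds (α : ℝ) (hα0 : 0 < α) (hα1 : α < 1) :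
    ∃ C : ℝ, ∀ θ : ℝ, 0 < θ → |zetaFn α θ| ≤ C ∧ |θ * zetaFn α θ| ≤ C * θ ^ (-1 / α) := by
  have hw := auxw_re α hα0 hα1
  set A := (1 / (α * Real.pi)) * ((auxw α).re ^ (-1 / α) * Real.Gamma (1 / α + 1)) with hA
  set B := (1 / (α * Real.pi)) * (2 * ∫ r in Set.Ioi (0:ℝ), r ^ α * Real.exp (-(auxz α).re * r ^ (1:ℝ))) with hB
  refine ⟨max A B, fun θ hθ => ?_⟩
  have hpi := Real.pi_pos
  have hk : 0 < 1 / (α * Real.pi) := by positivity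
  have e : |zetaFn α θ| = 1 / (α * Real.pi) * θ⁻¹ * |(auxz α * auxG α θ).im| := by
    rw [zetaFn_eq α θ hα0 hα1 hθ, abs_mul, abs_mul, abs_neg, abs_of_pos hk, abs_of_pos (inv_pos.mpr hθ)]
  constructor
  · refine le_trans ?_ (le_max_right A B)
    have h1 : |(auxz α * auxG α θ).im| ≤ 2 * θ * ∫ r in Set.Ioi (0:ℝ), r ^ α * Real.exp (-(auxz α).re * r ^ (1:ℝ)) := by
      refine le_trans ?_ (aux_intB α θ hα0 hα1 hθ)
      have := Complex.abs_im_le_norm (auxz α * auxG α θ - 1)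
      simpa only [Complex.sub_im, Complex.one_im, sub_zero] using this
    rw [e]
    calc _ ≤ 1 / (α * Real.pi) * θ⁻¹ * (2 * θ * ∫ r in Set.Ioi (0:ℝ), r ^ α * Real.exp (-(auxz α).re * r ^ (1:ℝ))) := by gcongr
      _ = B := by rw [hB]; field_simp
  · have h1 : |(auxz α * auxG α θ).im| ≤ (θ * (auxw α).re) ^ (-1 / α) * Real.Gamma (1 / α + 1) := by
      refine (Complex.abs_im_le_norm _).trans ?_
      rw [norm_mul, auxz_norm, one_mul]
      exact aux_intA α θ hα0 hα1 hθ
    have h2 : |θ * zetaFn α θ| ≤ A * θ ^ (-1 / α) := by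
      rw [abs_mul, e, abs_of_pos hθ]
      calc _ = 1 / (α * Real.pi) * |(auxz α * auxG α θ).im| := by field_simp
        _ ≤ 1 / (α * Real.pi) * ((θ * (auxw α).re) ^ (-1 / α) * Real.Gamma (1 / α + 1)) := by gcongr
        _ = _ := by rw [Real.mul_rpow hθ.le hw.le, hA]; ring
    refine h2.trans ?_
    gcongr
    exact le_max_left _ _

lemma zetaFn_integrable (α : ℝ) (hα0 : 0 < α) (hα1 : α < 1) :
    IntegrableOn (zetaFn α) (Set.Ioi 0) ∧ IntegrableOn (fun θ => θ * zetaFn α θ) (Set.Ioi 0) := by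
  obtain ⟨C, hC⟩ := zetaFn_bounds α hα0 hα1
  have m1 := zetaFn_meas α hα0 hα1
  have m2 : AEStronglyMeasurable (fun θ => θ * zetaFn α θ) (volume.restrict (Set.Ioi 0)) :=
    (measurable_id.aestronglyMeasurable).mul m1
  have hlt : -1 / α < -1 := by
    rw [div_lt_iff₀ hα0]; linarith
  have hI : IntegrableOn (fun θ : ℝ => C * θ ^ (-1 / α)) (Set.Ioi 1) :=
    (integrableOn_Ioi_rpow_of_lt hlt one_pos).const_mul C
  have hc : IntegrableOn (fun _ : ℝ => C) (Set.Ioc 0 1) := by simp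
  have hs1 : Set.Ioc (0:ℝ) 1 ⊆ Set.Ioi 0 := Set.Ioc_subset_Ioi_self
  have hs2 : Set.Ioi (1:ℝ) ⊆ Set.Ioi 0 := Set.Ioi_subset_Ioi zero_le_one
  rw [← Set.Ioc_union_Ioi_eq_Ioi (zero_le_one (α := ℝ))]
  refine ⟨IntegrableOn.union ?_ ?_, IntegrableOn.union ?_ ?_⟩
  · refine hc.mono' (m1.mono_set hs1) ?_
    filter_upwards [ae_restrict_mem measurableSet_Ioc] with θ hθ
    exact (hC θ hθ.1).1
  · refine hI.mono' (m1.mono_set hs2) ?_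
    filter_upwards [ae_restrict_mem measurableSet_Ioi] with θ hθ
    have hθ : 1 < θ := hθ
    have h := (hC θ (by linarith)).2
    rw [abs_mul, abs_of_pos (by linarith : 0 < θ)] at h
    rw [Real.norm_eq_abs]
    nlinarith [abs_nonneg (zetaFn α θ)]
  · refine hc.mono' (m2.mono_set hs1) ?_
    filter_upwards [ae_restrict_mem measurableSet_Ioc] with θ hθ
    have h := (hC θ hθ.1).1
    rw [Real.norm_eq_abs, abs_mul, abs_of_pos hθ.1]
    nlinarith [abs_nonneg (zetaFn α θ), hθ.1, hθ.2]
  · refine hI.mono' (m2.mono_set hs2) ?_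
    filter_upwards [ae_restrict_mem measurableSet_Ioi] with θ hθ
    have hθ : 1 < θ := hθ
    exact (hC θ (by linarith)).2

lemma aux_cont {X Y : Type*} [NormedAddCommGroup X] [NormedSpace ℝ X]
    [NormedAddCommGroup Y] [NormedSpace ℝ Y]
    (Linv : Y →L[ℝ] X)
    (Q : ℝ → Y →L[ℝ] Y) (M₀ : ℝ) (hQ : ∀ t, 0 ≤ t → ‖Q t‖ ≤ M₀)
    (hQcont : ∀ u : Y, ContinuousOn (fun t => Q t u) (Set.Ici 0))
    (α : ℝ) (hα0 : 0 < α) (u : Y) (g : ℝ → ℝ) (hg : IntegrableOn g (Set.Ioi 0)) :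
    ContinuousOn
        (fun t : ℝ => ∫ θ in Set.Ioi (0 : ℝ), g θ • Linv (Q (t ^ α * θ) u)) (Set.Ici 0) := by
  refine continuousOn_of_dominated (bound := fun θ => ‖g θ‖ * (‖Linv‖ * (M₀ * ‖u‖))) ?_ ?_ ?_ ?_
  · intro t ht
    have ht : 0 ≤ t := ht
    refine hg.aestronglyMeasurable.smul ?_
    apply ContinuousOn.aestronglyMeasurable _ measurableSet_Ioi
    refine Linv.continuous.comp_continuousOn ?_
    refine (hQcont u).comp (f := fun θ : ℝ => t ^ α * θ) (by fun_prop) ?_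
    intro θ hθ
    have hθ : 0 < θ := hθ
    simp only [Set.mem_Ici]; positivity
  · intro t ht
    have ht : 0 ≤ t := ht
    filter_upwards [ae_restrict_mem measurableSet_Ioi] with θ hθ
    have hθ : 0 < θ := hθ
    rw [norm_smul]
    gcongr
    refine (Linv.le_opNorm _).trans ?_
    gcongr
    refine ((Q _).le_opNorm _).trans ?_
    gcongr
    exact hQ _ (by positivity)
  · exact hg.norm.mul_const _
  · filter_upwards [ae_restrict_mem measurableSet_Ioi] with θ hθ
    have hθ : 0 < θ := hθ
    apply ContinuousOn.const_smul
    refine Linv.continuous.comp_continuousOn ?_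
    refine (hQcont u).comp (f := fun t : ℝ => t ^ α * θ) ?_ ?_
    · exact ((Real.continuous_rpow_const hα0.le).mul continuous_const).continuousOn
    · intro t ht
      have ht : 0 ≤ t := ht
      simp only [Set.mem_Ici]; positivity

theorem strong_continuity_of_S_and_T
    {X Y : Type*} [NormedAddCommGroup X] [NormedSpace ℝ X] [CompleteSpace X]
    [NormedAddCommGroup Y] [NormedSpace ℝ Y] [CompleteSpace Y]
    (Linv : Y →L[ℝ] X)
    (Q : ℝ → Y →L[ℝ] Y) (M₀ : ℝ) (hQ : ∀ t, 0 ≤ t → ‖Q t‖ ≤ M₀)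
    (hQcont : ∀ u : Y, ContinuousOn (fun t => Q t u) (Set.Ici 0))
    (α : ℝ) (hα0 : 0 < α) (hα1 : α < 1) :
    ∀ u : Y,
      ContinuousOn
        (fun t : ℝ => ∫ θ in Set.Ioi (0 : ℝ), zetaFn α θ • Linv (Q (t ^ α * θ) u))
        (Set.Ici 0) ∧
      ContinuousOn
        (fun t : ℝ => α • ∫ θ in Set.Ioi (0 : ℝ), (θ * zetaFn α θ) • Linv (Q (t ^ α * θ) u))
        (Set.Ici 0) := by
  intro u
  obtain ⟨h1, h2⟩ := zetaFn_integrable α hα0 hα1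
  exact ⟨aux_cont Linv Q M₀ hQ hQcont α hα0 u _ h1,
    (aux_cont Linv Q M₀ hQ hQcont α hα0 u _ h2).const_smul α⟩
end

section
/- For every 0 < α < 1, the function ζ_α is a probability density on (0,∞): ζ_α(θ) ≥ 0 for all θ ∈ (0,∞) and ∫₀^∞ ζ_α(θ) dθ = 1. -/
open MeasureTheory

/-- Coefficients of `(1-X)^(x-1)`. -/
noncomputable def dC (x : ℝ) (n : ℕ) : ℝ := ∏ k ∈ Finset.range n, (1 - x / ((k : ℝ) + 1))

/-- The power series `(1-X)^r`. -/
noncomputable def qS (r : ℝ) : PowerSeries ℝ :=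
  PowerSeries.rescale (-1 : ℝ) (PowerSeries.binomialSeries ℝ r)

lemma qS_add (r s : ℝ) : qS (r + s) = qS r * qS s := by
  simp [qS]

lemma qS_pow (r : ℝ) (j : ℕ) : qS r ^ j = qS (r * j) := by
  induction j with
  | zero => simp [qS]
  | succ j ih =>
    rw [pow_succ, ih, ← qS_add]
    congr 1
    push_cast
    ring

lemma dC_succ (x : ℝ) (n : ℕ) : dC x (n + 1) = dC x n * (1 - x / ((n : ℝ) + 1)) := by
  simp [dC, Finset.prod_range_succ]

lemma coeff_qS (r : ℝ) (n : ℕ) : PowerSeries.coeff n (qS r) = dC (r + 1) n := by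
  have h : ∀ n : ℕ, (-1 : ℝ) ^ n * Ring.choose r n = dC (r + 1) n := by
    intro n
    rw [Ring.choose_eq_smul]
    induction n with
    | zero => simp [dC]
    | succ n ih =>
      rw [dC_succ, ← ih]
      simp only [descPochhammer_succ_right, Polynomial.smeval_mul, Polynomial.smeval_sub,
        Polynomial.smeval_X, Polynomial.smeval_natCast, Nat.factorial_succ, smul_eq_mul]
      have h1 : ((n : ℝ) + 1) ≠ 0 := by positivity
      have h2 : (n.factorial : ℝ) ≠ 0 := by positivity
      push_cast
      simp only [pow_one, pow_zero, nsmul_eq_mul, mul_one]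
      field_simp
      ring
  simp [qS, PowerSeries.coeff_rescale, h]

/-- the discrete distribution functions -/
noncomputable def sN (α : ℝ) (K n : ℕ) : ℝ :=
  PowerSeries.coeff n ((1 - qS α) ^ K * qS (-1))

lemma dC_zero_left (n : ℕ) : dC 0 n = 1 := by simp [dC]

lemma sN_zero (α : ℝ) (n : ℕ) : sN α 0 n = 1 := by
  simp [sN, coeff_qS, dC_zero_left]

lemma sN_eq (α : ℝ) (K n : ℕ) :
    sN α K n = ∑ j ∈ Finset.range (K + 1), (K.choose j : ℝ) * (-1) ^ j * dC (α * j) n := by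
  have h : (1 - qS α) ^ K * qS (-1) = ∑ j ∈ Finset.range (K + 1),
      PowerSeries.C ((K.choose j : ℝ) * (-1) ^ j) * qS (α * j - 1) := by
    rw [sub_eq_neg_add, add_pow, Finset.sum_mul]
    refine Finset.sum_congr rfl fun j _ => ?_
    rw [neg_pow, qS_pow, one_pow, sub_eq_add_neg, qS_add]
    simp only [map_mul, map_pow, map_neg, map_one, map_natCast]
    ring
  rw [sN, h, map_sum]
  refine Finset.sum_congr rfl fun j _ => ?_
  rw [PowerSeries.coeff_C_mul, coeff_qS, sub_add_cancel]

/-- step probabilities -/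
noncomputable def aC (α : ℝ) (k : ℕ) : ℝ := PowerSeries.coeff k (1 - qS α)

lemma aC_nonneg {α : ℝ} (h0 : 0 < α) (h1 : α < 1) (k : ℕ) : 0 ≤ aC α k := by
  cases k with
  | zero =>
    rw [aC, map_sub, coeff_qS]
    simp [dC]
  | succ k =>
    have hk : PowerSeries.coeff (k + 1) (1 : PowerSeries ℝ) = 0 := by
      simp [PowerSeries.coeff_one]
    rw [aC, map_sub, coeff_qS, hk, dC, Finset.prod_range_succ']
    have : 0 ≤ ∏ k ∈ Finset.range k, (1 - (α + 1) / (((k + 1 : ℕ) : ℝ) + 1)) := by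
      refine Finset.prod_nonneg fun i _ => ?_
      rw [sub_nonneg, div_le_one (by positivity)]
      push_cast
      have : (0 : ℝ) ≤ i := by positivity
      linarith
    simp only [Nat.cast_zero, zero_add, div_one]
    nlinarith

lemma sN_succ (α : ℝ) (K n : ℕ) :
    sN α (K + 1) n = ∑ k ∈ Finset.range (n + 1), aC α k * sN α K (n - k) := by
  rw [sN, pow_succ', mul_assoc, PowerSeries.coeff_mul, Finset.Nat.sum_antidiagonal_eq_sum_range_succ_mk]
  rfl

lemma sum_aC (α : ℝ) (n : ℕ) : ∑ k ∈ Finset.range (n + 1), aC α k = 1 - dC α n := by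
  have h := sN_succ α 0 n
  simp only [sN_zero, mul_one] at h
  rw [← h, sN_eq]
  simp [Finset.sum_range_succ, dC_zero_left]
  ring

lemma dC_nonneg {α : ℝ} (h1 : α < 1) (n : ℕ) : 0 ≤ dC α n := by
  refine Finset.prod_nonneg fun i _ => ?_
  rw [sub_nonneg, div_le_one (by positivity)]
  have : (0 : ℝ) ≤ i := by positivity
  linarith

lemma sN_nonneg_mono {α : ℝ} (h0 : 0 < α) (h1 : α < 1) (K : ℕ) :
    (∀ n, 0 ≤ sN α K n) ∧ Monotone (sN α K) := by
  induction K with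
  | zero =>
    have : sN α 0 = fun _ => 1 := funext (sN_zero α)
    rw [this]
    exact ⟨fun _ => zero_le_one, monotone_const⟩
  | succ K ih =>
    refine ⟨fun n => ?_, monotone_nat_of_le_succ fun n => ?_⟩
    · rw [sN_succ]
      exact Finset.sum_nonneg fun k _ => mul_nonneg (aC_nonneg h0 h1 k) (ih.1 _)
    · rw [sN_succ, sN_succ, Finset.sum_range_succ _ (n + 1)]
      have : ∑ k ∈ Finset.range (n + 1), aC α k * sN α K (n - k)
          ≤ ∑ k ∈ Finset.range (n + 1), aC α k * sN α K (n + 1 - k) :=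
        Finset.sum_le_sum fun k _ => mul_le_mul_of_nonneg_left (ih.2 (by omega)) (aC_nonneg h0 h1 k)
      have := mul_nonneg (aC_nonneg h0 h1 (n + 1)) (ih.1 (n + 1 - (n + 1)))
      linarith

lemma sN_succ_le {α : ℝ} (h0 : 0 < α) (h1 : α < 1) (K n : ℕ) :
    sN α (K + 1) n ≤ (1 - dC α n) * sN α K n := by
  rw [sN_succ, ← sum_aC, Finset.sum_mul]
  exact Finset.sum_le_sum fun k _ =>
    mul_le_mul_of_nonneg_left ((sN_nonneg_mono h0 h1 K).2 (by omega)) (aC_nonneg h0 h1 k)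

lemma sN_antitone {α : ℝ} (h0 : 0 < α) (h1 : α < 1) (n : ℕ) : Antitone (fun K => sN α K n) := by
  refine antitone_nat_of_succ_le fun K => ?_
  have := sN_succ_le h0 h1 K n
  nlinarith [dC_nonneg h1 n, (sN_nonneg_mono h0 h1 K).1 n]

lemma sN_le_exp {α : ℝ} (h0 : 0 < α) (h1 : α < 1) (K n : ℕ) :
    sN α K n ≤ Real.exp (-(K * dC α n)) := by
  induction K with
  | zero => simp [sN_zero]
  | succ K ih =>
    have h2 := Real.add_one_le_exp (-dC α n)
    calc sN α (K + 1) n ≤ (1 - dC α n) * sN α K n := sN_succ_le h0 h1 K n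
      _ ≤ Real.exp (-dC α n) * sN α K n :=
        mul_le_mul_of_nonneg_right (by linarith) ((sN_nonneg_mono h0 h1 K).1 n)
      _ ≤ Real.exp (-dC α n) * Real.exp (-(K * dC α n)) :=
        mul_le_mul_of_nonneg_left ih (Real.exp_pos _).le
      _ = _ := by
        rw [← Real.exp_add]
        congr 1
        push_cast
        ring

lemma dC_abs_le_one {x : ℝ} (hx : 0 ≤ x) : |dC x ⌊x⌋₊| ≤ 1 := by
  set m := ⌊x⌋₊ with hm
  have hmx : (m : ℝ) ≤ x := Nat.floor_le hx
  have hxm : x < m + 1 := Nat.lt_floor_add_one x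
  rw [dC, Finset.abs_prod]
  calc ∏ k ∈ Finset.range m, |1 - x / ((k : ℝ) + 1)|
      ≤ ∏ k ∈ Finset.range m, (((m - 1 - k : ℕ) : ℝ) + 1) / ((k : ℝ) + 1) := by
        refine Finset.prod_le_prod (fun _ _ => abs_nonneg _) fun k hk => ?_
        rw [Finset.mem_range] at hk
        have hk' : (k : ℝ) + 1 ≤ m := by exact_mod_cast hk
        have h1 : (((m - 1 - k : ℕ) : ℝ) + 1) = m - k := by
          rw [Nat.sub_sub, Nat.cast_sub (by omega)]
          push_cast
          ring
        have hk0 : (0 : ℝ) < (k : ℝ) + 1 := by positivity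
        rw [h1, abs_sub_comm, abs_of_nonneg]
        · rw [sub_le_iff_le_add, div_le_iff₀ hk0, add_mul, div_mul_cancel₀ _ hk0.ne']
          linarith
        · rw [sub_nonneg, le_div_iff₀ hk0]
          linarith
    _ = 1 := by
        rw [Finset.prod_div_distrib,
          Finset.prod_range_reflect (fun k : ℕ => ((k : ℝ) + 1)) m]
        exact div_self (Finset.prod_ne_zero_iff.2 fun k _ => by positivity)

lemma dC_abs_le_aux {x : ℝ} (hx : 0 ≤ x) (n : ℕ) (hn : ⌊x⌋₊ ≤ n) :
    ((n : ℝ) + 1) ^ x * |dC x n| ≤ ((⌊x⌋₊ : ℝ) + 1) ^ x := by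
  induction n, hn using Nat.le_induction with
  | base =>
    have := dC_abs_le_one hx
    have h2 : 0 ≤ ((⌊x⌋₊ : ℝ) + 1) ^ x := by positivity
    nlinarith
  | succ n hn ih =>
    refine le_trans ?_ ih
    have hxm : x < ⌊x⌋₊ + 1 := Nat.lt_floor_add_one x
    have hn' : (⌊x⌋₊ : ℝ) ≤ n := by exact_mod_cast hn
    have hp : (0 : ℝ) < (n : ℝ) + 1 := by positivity
    have hf : 0 ≤ 1 - x / ((n : ℝ) + 1) := by
      rw [sub_nonneg, div_le_one hp]
      linarith
    rw [dC_succ, abs_mul, abs_of_nonneg hf]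
    have key : ((n + 1 : ℕ) + 1 : ℝ) ^ x * (1 - x / ((n : ℝ) + 1)) ≤ ((n : ℝ) + 1) ^ x := by
      have e1 : ((n + 1 : ℕ) + 1 : ℝ) = ((n : ℝ) + 1) * (1 + 1 / ((n : ℝ) + 1)) := by
        push_cast
        field_simp
      have e2 : (1 + 1 / ((n : ℝ) + 1)) ^ x ≤ Real.exp (x / ((n : ℝ) + 1)) := by
        have h3 := Real.add_one_le_exp (1 / ((n : ℝ) + 1))
        calc (1 + 1 / ((n : ℝ) + 1)) ^ x ≤ (Real.exp (1 / ((n : ℝ) + 1))) ^ x :=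
              Real.rpow_le_rpow (by positivity) (by linarith) hx
          _ = _ := by
            rw [← Real.exp_mul]
            congr 1
            ring
      have e3 : 1 - x / ((n : ℝ) + 1) ≤ Real.exp (-(x / ((n : ℝ) + 1))) := by
        have := Real.add_one_le_exp (-(x / ((n : ℝ) + 1)))
        linarith
      rw [e1, Real.mul_rpow (by positivity) (by positivity), mul_assoc]
      have : (1 + 1 / ((n : ℝ) + 1)) ^ x * (1 - x / ((n : ℝ) + 1)) ≤ 1 := by
        calc _ ≤ Real.exp (x / ((n : ℝ) + 1)) * Real.exp (-(x / ((n : ℝ) + 1))) :=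
              mul_le_mul e2 e3 hf (Real.exp_pos _).le
          _ = 1 := by rw [← Real.exp_add]; simp
      exact mul_le_of_le_one_right (by positivity) this
    calc _ = (((n + 1 : ℕ) + 1 : ℝ) ^ x * (1 - x / ((n : ℝ) + 1))) * |dC x n| := by ring
      _ ≤ _ := mul_le_mul_of_nonneg_right key (abs_nonneg _)

lemma dC_abs_le {x : ℝ} (hx : 0 ≤ x) (n : ℕ) (hn : x ≤ n) :
    (n : ℝ) ^ x * |dC x n| ≤ (x + 1) ^ x := by
  have h := dC_abs_le_aux hx n (Nat.floor_le_of_le hn)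
  have h1 : (n : ℝ) ^ x ≤ ((n : ℝ) + 1) ^ x :=
    Real.rpow_le_rpow (by positivity) (by linarith) hx
  have h2 : ((⌊x⌋₊ : ℝ) + 1) ^ x ≤ (x + 1) ^ x :=
    Real.rpow_le_rpow (by positivity) (by linarith [Nat.floor_le hx]) hx
  exact (mul_le_mul_of_nonneg_right h1 (abs_nonneg _)).trans (h.trans h2)

open Filter Topology in
lemma dC_tendsto (x : ℝ) :
    Tendsto (fun n : ℕ => (n : ℝ) ^ x * dC x n) atTop (𝓝 (Real.Gamma (1 - x))⁻¹) := by
  by_cases hG : ∃ m : ℕ, 1 - x = -(m : ℝ)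
  · rw [(Real.Gamma_eq_zero_iff _).2 hG, inv_zero]
    obtain ⟨m, hm⟩ := hG
    refine tendsto_const_nhds.congr' ?_
    filter_upwards [eventually_gt_atTop m] with n hn
    have : dC x n = 0 := by
      refine Finset.prod_eq_zero (Finset.mem_range.2 hn) ?_
      have : x = m + 1 := by linarith
      rw [this, div_self (by positivity), sub_self]
    simp [this]
  · by_cases hx : x = 0
    · subst hx
      simp [dC_zero_left]
    have hG0 : Real.Gamma (1 - x) ≠ 0 := fun h => hG ((Real.Gamma_eq_zero_iff _).1 h)
    have hrec : Real.Gamma (1 - x) = -x * Real.Gamma (-x) := by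
      rw [← Real.Gamma_add_one (neg_ne_zero.2 hx)]
      congr 1
      ring
    have hG1 : Real.Gamma (-x) ≠ 0 := fun h => hG0 (by rw [hrec, h, mul_zero])
    have ht := ((Real.GammaSeq_tendsto_Gamma (-x)).inv₀ hG1).const_mul ((-x)⁻¹)
    rw [hrec, mul_inv]
    refine ht.congr' ?_
    filter_upwards [eventually_gt_atTop 0] with n hn
    have hprod : ∏ j ∈ Finset.range (n + 1), (-x + (j : ℝ)) = -x * (n.factorial * dC x n) := by
      clear hn
      induction n with
      | zero => simp [dC]
      | succ n ih =>
        rw [Finset.prod_range_succ, ih, dC_succ, Nat.factorial_succ]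
        push_cast
        have : (n : ℝ) + 1 ≠ 0 := by positivity
        field_simp
        ring
    rw [Real.GammaSeq, hprod, Real.rpow_neg (by positivity)]
    have h1 : (n : ℝ) ^ x ≠ 0 := by positivity
    have h2 : (n.factorial : ℝ) ≠ 0 := by positivity
    rw [inv_div]
    field_simp

open Filter Topology

/-- majorant of the coefficients -/
noncomputable def bB (α : ℝ) (j : ℕ) : ℝ := (α * j + 1) ^ (α * j)

lemma bB_nonneg {α : ℝ} (h0 : 0 < α) (j : ℕ) : 0 ≤ bB α j := by
  unfold bB
  positivity

lemma invGamma_le {α : ℝ} (h0 : 0 < α) (j : ℕ) : |(Real.Gamma (1 - α * j))⁻¹| ≤ bB α j := by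
  have hx : 0 ≤ α * j := by positivity
  refine le_of_tendsto (dC_tendsto (α * j)).abs ?_
  obtain ⟨N, hN⟩ := exists_nat_ge (α * (j : ℝ))
  filter_upwards [eventually_ge_atTop N] with n hn
  have hn' : (N : ℝ) ≤ n := by exact_mod_cast hn
  have := dC_abs_le hx n (hN.trans hn')
  rw [abs_mul, abs_of_nonneg (by positivity)]
  exact this

lemma summable_bB {α : ℝ} (h0 : 0 < α) (h1 : α < 1) (R : ℝ) (hR : 0 ≤ R) :
    Summable (fun j : ℕ => R ^ j / (j.factorial : ℝ) * bB α j) := by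
  have hlim : Tendsto (fun j : ℕ => R * Real.exp 1 * 2 * (j : ℝ) ^ (-(1 - α))) atTop (𝓝 0) := by
    have := (tendsto_rpow_neg_atTop (sub_pos.2 h1)).comp
        (tendsto_natCast_atTop_atTop (R := ℝ))
    simpa using this.const_mul (R * Real.exp 1 * 2)
  refine Summable.of_norm_bounded_eventually_nat
    (summable_geometric_of_lt_one (by norm_num) (by norm_num : (1 / 2 : ℝ) < 1)) ?_
  filter_upwards [hlim.eventually_le_const (by norm_num : (0 : ℝ) < 1 / 2),
    eventually_gt_atTop 0] with j hj hj0
  have hj0' : (1 : ℝ) ≤ j := by exact_mod_cast hj0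
  have hjp : (0 : ℝ) < j := by linarith
  have hnn : 0 ≤ R ^ j / (j.factorial : ℝ) * bB α j :=
    mul_nonneg (by positivity) (bB_nonneg h0 j)
  rw [Real.norm_of_nonneg hnn]
  have hb : bB α j ≤ (2 * (j : ℝ) ^ α) ^ j := by
    have hbase : α * j + 1 ≤ 2 * j := by nlinarith
    calc bB α j ≤ (2 * (j : ℝ)) ^ (α * j) :=
          Real.rpow_le_rpow (by positivity) hbase (by positivity)
      _ = ((2 * (j : ℝ)) ^ α) ^ j := by rw [Real.rpow_mul (by positivity), Real.rpow_natCast]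
      _ ≤ _ := by
          refine pow_le_pow_left₀ (by positivity) ?_ j
          rw [Real.mul_rpow (by norm_num) hjp.le]
          refine mul_le_mul_of_nonneg_right ?_ (by positivity)
          calc (2 : ℝ) ^ α ≤ 2 ^ (1 : ℝ) :=
                Real.rpow_le_rpow_of_exponent_le (by norm_num) h1.le
            _ = 2 := Real.rpow_one 2
  have hfac : 1 / (j.factorial : ℝ) ≤ (Real.exp 1 / j) ^ j := by
    have := Real.pow_div_factorial_le_exp (j : ℝ) hjp.le j
    have e : Real.exp (j : ℝ) = Real.exp 1 ^ j := by rw [← Real.exp_nat_mul, mul_one]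
    rw [e] at this
    rw [div_pow, le_div_iff₀ (by positivity)]
    calc _ = (j : ℝ) ^ j / (j.factorial : ℝ) := by ring
      _ ≤ _ := this
  calc R ^ j / (j.factorial : ℝ) * bB α j = R ^ j * (1 / (j.factorial : ℝ)) * bB α j := by ring
    _ ≤ R ^ j * (Real.exp 1 / j) ^ j * (2 * (j : ℝ) ^ α) ^ j := by
        gcongr
        exact bB_nonneg h0 j
    _ = (R * Real.exp 1 * 2 * (j : ℝ) ^ (-(1 - α))) ^ j := by
        rw [← mul_pow, ← mul_pow]
        congr 1
        have : (j : ℝ) ^ (-(1 - α)) = (j : ℝ) ^ α / j := by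
          rw [show -(1 - α) = α - 1 by ring, Real.rpow_sub hjp, Real.rpow_one]
        rw [this]
        ring
    _ ≤ _ := pow_le_pow_left₀ (by positivity) hj j

/-- terms of the tail function -/
noncomputable def wT (α : ℝ) (j : ℕ) (θ : ℝ) : ℝ :=
  θ ^ j / (j.factorial : ℝ) * (-1) ^ j * (Real.Gamma (1 - α * j))⁻¹

/-- tail function of the density -/
noncomputable def wF (α θ : ℝ) : ℝ := ∑' j : ℕ, wT α j θ

lemma wT_abs_le {α : ℝ} (h0 : 0 < α) (j : ℕ) (θ : ℝ) :
    ‖wT α j θ‖ ≤ |θ| ^ j / (j.factorial : ℝ) * bB α j := by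
  rw [wT, Real.norm_eq_abs, abs_mul, abs_mul, abs_div, abs_pow, abs_pow, abs_neg, abs_one, one_pow,
    mul_one, Nat.abs_cast]
  exact mul_le_mul_of_nonneg_left (invGamma_le h0 j) (by positivity)

lemma descFactorial_tendsto {K : ℕ → ℕ} {M : ℕ → ℝ} {θ : ℝ} (hθ : 0 ≤ θ)
    (hM : Tendsto M atTop atTop) (h : Tendsto (fun n => (K n : ℝ) / M n) atTop (𝓝 θ)) (j : ℕ) :
    Tendsto (fun n => ((K n).descFactorial j : ℝ) / M n ^ j) atTop (𝓝 (θ ^ j)) := by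
  induction j with
  | zero => simp
  | succ j ih =>
    have h1 : Tendsto (fun n => ((K n - j : ℕ) : ℝ) / M n) atTop (𝓝 θ) := by
      have h2 : Tendsto (fun n => max ((K n : ℝ) / M n - j / M n) 0) atTop (𝓝 (max (θ - 0) 0)) :=
        (h.sub (hM.const_div_atTop (j : ℝ))).max tendsto_const_nhds
      rw [sub_zero, max_eq_left hθ] at h2
      refine h2.congr' ?_
      filter_upwards [hM.eventually_gt_atTop 0] with n hn
      rcases le_total j (K n) with hj | hj
      · rw [Nat.cast_sub hj, ← sub_div, max_eq_left]
        have : (j : ℝ) ≤ K n := by exact_mod_cast hj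
        exact div_nonneg (by linarith) hn.le
      · rw [Nat.sub_eq_zero_of_le hj, ← sub_div, max_eq_right]
        · simp
        · have : (K n : ℝ) ≤ j := by exact_mod_cast hj
          exact div_nonpos_of_nonpos_of_nonneg (by linarith) hn.le
    rw [pow_succ']
    refine (h1.mul ih).congr fun n => ?_
    rw [Nat.descFactorial_succ, pow_succ']
    push_cast
    rw [div_mul_div_comm]

/-- number of steps -/
noncomputable def kN (α θ : ℝ) (n : ℕ) : ℕ := ⌊θ * (n : ℝ) ^ α⌋₊

lemma natpow_tendsto {α : ℝ} (h0 : 0 < α) :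
    Tendsto (fun n : ℕ => (n : ℝ) ^ α) atTop atTop :=
  (tendsto_rpow_atTop h0).comp tendsto_natCast_atTop_atTop

lemma kN_tendsto {α θ : ℝ} (h0 : 0 < α) (hθ : 0 ≤ θ) :
    Tendsto (fun n => (kN α θ n : ℝ) / (n : ℝ) ^ α) atTop (𝓝 θ) :=
  (tendsto_nat_floor_mul_div_atTop hθ).comp (natpow_tendsto h0)

lemma sN_tendsto {α θ : ℝ} (h0 : 0 < α) (h1 : α < 1) (hθ : 0 ≤ θ) :
    Tendsto (fun n => sN α (kN α θ n) n) atTop (𝓝 (wF α θ)) := by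
  have hs : ∀ n, sN α (kN α θ n) n =
      ∑' j : ℕ, ((kN α θ n).choose j : ℝ) * (-1) ^ j * dC (α * j) n := by
    intro n
    rw [sN_eq, tsum_eq_sum]
    intro j hj
    rw [Finset.mem_range, not_lt] at hj
    rw [Nat.choose_eq_zero_of_lt (by omega)]
    simp
  simp_rw [hs]
  refine tendsto_tsum_of_dominated_convergence (summable_bB h0 h1 θ hθ) (fun j => ?_) ?_
  · have hd := descFactorial_tendsto hθ (natpow_tendsto h0) (kN_tendsto h0 hθ) j
    have := ((hd.div_const (j.factorial : ℝ)).mul_const ((-1 : ℝ) ^ j)).mul (dC_tendsto (α * j))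
    refine this.congr' ?_
    filter_upwards [eventually_gt_atTop 0] with n hn
    have hn' : (0 : ℝ) < n := by exact_mod_cast hn
    rw [Nat.descFactorial_eq_factorial_mul_choose, Real.rpow_mul hn'.le, Real.rpow_natCast]
    have hp : (n : ℝ) ^ α ≠ 0 := by positivity
    have hf : (j.factorial : ℝ) ≠ 0 := by positivity
    push_cast
    field_simp
  · have hlim : Tendsto (fun n : ℕ => α * θ * (n : ℝ) ^ (-(1 - α))) atTop (𝓝 0) := by
      have := (tendsto_rpow_neg_atTop (sub_pos.2 h1)).comp
        (tendsto_natCast_atTop_atTop (R := ℝ))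
      simpa using this.const_mul (α * θ)
    filter_upwards [hlim.eventually_le_const (by norm_num : (0 : ℝ) < 1),
      eventually_gt_atTop 0] with n hn hn0 j
    have hnp : (0 : ℝ) < n := by exact_mod_cast hn0
    have hk : (kN α θ n : ℝ) ≤ θ * (n : ℝ) ^ α := Nat.floor_le (by positivity)
    rcases lt_or_ge (kN α θ n) j with hj | hj
    · rw [Nat.choose_eq_zero_of_lt hj]
      simp only [Nat.cast_zero, zero_mul, norm_zero]
      exact mul_nonneg (by positivity) (bB_nonneg h0 j)
    · have hj' : (j : ℝ) ≤ kN α θ n := by exact_mod_cast hj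
      have hx : α * j ≤ n := by
        have e : (n : ℝ) ^ (-(1 - α)) = (n : ℝ) ^ α / n := by
          rw [show -(1 - α) = α - 1 by ring, Real.rpow_sub hnp, Real.rpow_one]
        rw [e, ← mul_div_assoc, div_le_one hnp] at hn
        calc α * j ≤ α * (θ * (n : ℝ) ^ α) := mul_le_mul_of_nonneg_left (hj'.trans hk) h0.le
          _ ≤ n := by linarith
      have hd := dC_abs_le (by positivity) n hx
      rw [Real.norm_eq_abs, abs_mul, abs_mul, abs_pow, abs_neg, abs_one, one_pow, mul_one,
        Nat.abs_cast]
      calc ((kN α θ n).choose j : ℝ) * |dC (α * j) n|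
          ≤ ((kN α θ n : ℝ) ^ j / (j.factorial : ℝ)) * |dC (α * j) n| := by
            gcongr
            exact Nat.choose_le_pow_div j _
        _ ≤ ((θ * (n : ℝ) ^ α) ^ j / (j.factorial : ℝ)) * |dC (α * j) n| := by
            gcongr
        _ = θ ^ j / (j.factorial : ℝ) * ((n : ℝ) ^ (α * j) * |dC (α * j) n|) := by
            rw [Real.rpow_mul hnp.le, Real.rpow_natCast]
            ring
        _ ≤ _ := mul_le_mul_of_nonneg_left hd (by positivity)

lemma wF_antitone {α : ℝ} (h0 : 0 < α) (h1 : α < 1) : AntitoneOn (wF α) (Set.Ici 0) := by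
  intro a ha b hb hab
  refine le_of_tendsto_of_tendsto' (sN_tendsto h0 h1 hb) (sN_tendsto h0 h1 ha) fun n => ?_
  exact sN_antitone h0 h1 n (Nat.floor_le_floor (by gcongr))

lemma wF_nonneg {α θ : ℝ} (h0 : 0 < α) (h1 : α < 1) (hθ : 0 ≤ θ) : 0 ≤ wF α θ :=
  ge_of_tendsto' (sN_tendsto h0 h1 hθ) fun n => (sN_nonneg_mono h0 h1 _).1 n

lemma wF_le {α θ : ℝ} (h0 : 0 < α) (h1 : α < 1) (hθ : 0 ≤ θ) :
    wF α θ ≤ Real.exp (-(θ * (Real.Gamma (1 - α))⁻¹)) := by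
  refine le_of_tendsto_of_tendsto (sN_tendsto h0 h1 hθ) ?_
    (Eventually.of_forall fun n => sN_le_exp h0 h1 _ n)
  refine (Real.continuous_exp.tendsto _).comp (Tendsto.neg ?_)
  refine ((kN_tendsto h0 hθ).mul (dC_tendsto α)).congr' ?_
  filter_upwards [eventually_gt_atTop 0] with n hn
  have hn' : (0 : ℝ) < n := by exact_mod_cast hn
  have hp : (n : ℝ) ^ α ≠ 0 := by positivity
  field_simp

lemma wF_tendsto {α : ℝ} (h0 : 0 < α) (h1 : α < 1) : Tendsto (wF α) atTop (𝓝 0) := by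
  have hc : 0 < (Real.Gamma (1 - α))⁻¹ := inv_pos.2 (Real.Gamma_pos_of_pos (by linarith))
  have ht : Tendsto (fun θ : ℝ => Real.exp (-(θ * (Real.Gamma (1 - α))⁻¹))) atTop (𝓝 0) :=
    Real.tendsto_exp_neg_atTop_nhds_zero.comp (tendsto_id.atTop_mul_const hc)
  refine tendsto_of_tendsto_of_tendsto_of_le_of_le' tendsto_const_nhds ht ?_ ?_
  · filter_upwards [eventually_ge_atTop 0] with θ hθ using wF_nonneg h0 h1 hθ
  · filter_upwards [eventually_ge_atTop 0] with θ hθ using wF_le h0 h1 hθ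

lemma wF_zero (α : ℝ) : wF α 0 = 1 := by
  rw [wF, tsum_eq_single 0]
  · simp [wT]
  · intro j hj
    simp [wT, hj]

/-- derivative terms -/
noncomputable def wT' (α : ℝ) (j : ℕ) (θ : ℝ) : ℝ :=
  (j * θ ^ (j - 1)) / (j.factorial : ℝ) * (-1) ^ j * (Real.Gamma (1 - α * j))⁻¹

lemma wF_hasDerivAt {α : ℝ} (h0 : 0 < α) (h1 : α < 1) (θ : ℝ) :
    HasDerivAt (wF α) (∑' j : ℕ, wT' α j θ) θ := by
  set R : ℝ := |θ| + 1 with hR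
  have hR1 : 1 ≤ R := by linarith [abs_nonneg θ]
  refine hasDerivAt_tsum_of_isPreconnected (g := wT α) (g' := wT' α)
    (summable_bB h0 h1 (2 * R) (by positivity))
    (t := Metric.ball (0 : ℝ) R) (y₀ := 0) Metric.isOpen_ball
    (convex_ball (0 : ℝ) R).isPreconnected ?_ ?_ (by simp; linarith) ?_ (by simp [hR])
  · intro j y _
    exact (((hasDerivAt_pow j y).div_const _).mul_const _).mul_const _
  · intro j y hy
    rw [mem_ball_zero_iff, Real.norm_eq_abs] at hy
    rw [wT', Real.norm_eq_abs, abs_mul, abs_mul, abs_div, abs_mul, abs_pow, abs_pow, abs_neg,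
      abs_one, one_pow, mul_one, Nat.abs_cast, Nat.abs_cast]
    have hj : (j : ℝ) * |y| ^ (j - 1) ≤ (2 * R) ^ j := by
      rw [mul_pow]
      have a1 : (j : ℝ) ≤ 2 ^ j := by exact_mod_cast Nat.lt_two_pow_self.le
      have a2 : |y| ^ (j - 1) ≤ R ^ j :=
        (pow_le_pow_left₀ (abs_nonneg y) hy.le _).trans (pow_le_pow_right₀ hR1 (Nat.sub_le j 1))
      exact mul_le_mul a1 a2 (by positivity) (by positivity)
    exact mul_le_mul (by gcongr) (invGamma_le h0 j) (abs_nonneg _) (by positivity)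
  · refine Summable.of_norm_bounded (summable_bB h0 h1 0 le_rfl) fun j => ?_
    simpa using wT_abs_le h0 j 0

lemma zetaFn_eq_s4 {α θ : ℝ} (h0 : 0 < α) (h1 : α < 1) (hθ : 0 < θ) :
    ∑' j : ℕ, wT' α j θ = -zetaFn α θ := by
  have hzero : wT' α 0 θ = 0 := by simp [wT']
  have hshift : ∑' j : ℕ, wT' α j θ = ∑' j : ℕ, wT' α (j + 1) θ := by
    rw [← (Function.Injective.tsum_eq (g := Nat.succ) Nat.succ_injective (f := fun j => wT' α j θ))]
    intro j hj
    cases j with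
    | zero => exact absurd hzero hj
    | succ j => exact ⟨j, rfl⟩
  rw [hshift, zetaFn, wrightFn, ← mul_assoc, ← neg_mul, ← tsum_mul_left]
  refine tsum_congr fun n => ?_
  have hx : 0 < α * ((n : ℝ) + 1) := by positivity
  set x := α * ((n : ℝ) + 1) with hxd
  have hΓ : (Real.Gamma (1 - x))⁻¹ = Real.Gamma x * Real.sin (Real.pi * x) / Real.pi := by
    have hp := (Real.Gamma_pos_of_pos hx).ne'
    have := Real.Gamma_mul_Gamma_one_sub x
    have h2 : Real.Gamma (1 - x) = (Real.pi / Real.sin (Real.pi * x)) / Real.Gamma x := by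
      rw [← this]
      field_simp
    rw [h2, inv_div, div_div_eq_mul_div]
  have hpow : θ ^ (-1 - 1 / α) * (θ ^ (-(1 / α))) ^ (-x - 1) = θ ^ n := by
    rw [← Real.rpow_mul hθ.le, ← Real.rpow_add hθ, ← Real.rpow_natCast]
    congr 1
    rw [hxd]
    field_simp
    ring
  have e1 : ((n : ℝ) + 1) * α + 1 = x + 1 := by rw [hxd]; ring
  have e2 : ((n : ℝ) + 1) * Real.pi * α = Real.pi * x := by rw [hxd]; ring
  have e3 : (1 - α * ((n + 1 : ℕ) : ℝ)) = 1 - x := by rw [hxd]; push_cast; ring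
  rw [wT', e1, e2, e3, hΓ, Real.Gamma_add_one hx.ne', Nat.add_sub_cancel, ← hpow]
  have hxa : x / α = (n : ℝ) + 1 := by rw [hxd]; field_simp
  push_cast
  rw [← hxa, pow_succ]
  ring

theorem zetaFn_probability_density (α : ℝ) (hα0 : 0 < α) (hα1 : α < 1) :
    (∀ θ : ℝ, θ ∈ Set.Ioi (0 : ℝ) → 0 ≤ zetaFn α θ) ∧
    ∫ θ in Set.Ioi (0 : ℝ), zetaFn α θ = 1 := by
  have hd : ∀ θ ∈ Set.Ioi (0 : ℝ), HasDerivAt (wF α) (-zetaFn α θ) θ := by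
    intro θ hθ
    rw [← zetaFn_eq_s4 hα0 hα1 hθ]
    exact wF_hasDerivAt hα0 hα1 θ
  have hnn : ∀ θ : ℝ, θ ∈ Set.Ioi (0 : ℝ) → 0 ≤ zetaFn α θ := by
    intro θ hθ
    have h := (wF_antitone hα0 hα1).derivWithin_nonpos (x := θ)
    rw [(hd θ hθ).hasDerivWithinAt.derivWithin (uniqueDiffOn_Ici 0 θ (Set.mem_Ici.2 (le_of_lt hθ)))]
      at h
    linarith
  refine ⟨hnn, ?_⟩
  have := integral_Ioi_of_hasDerivAt_of_nonpos (g' := fun θ => -zetaFn α θ)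
    (wF_hasDerivAt hα0 hα1 0).continuousAt.continuousWithinAt hd
    (fun x hx => neg_nonpos.2 (hnn x hx)) (wF_tendsto hα0 hα1)
  rw [integral_neg, wF_zero] at this
  linarith
end

section
/- For every 0 < α < 1 and every v ∈ [0,1], one has the moment formula ∫₀^∞ θ^v ζ_α(θ) dθ = Γ(1+v)/Γ(1+αv); equivalently, ∫₀^∞ θ^{−αv} ϖ_α(θ) dθ = Γ(1+v)/Γ(1+αv). -/
open MeasureTheory

theorem real_integrable (ρ a : ℝ) (hρ : 0 < ρ) (ha : 0 < a) :
    IntegrableOn (fun t : ℝ => t ^ (a - 1) * Real.exp (-(ρ * t))) (Set.Ioi 0) := by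
  have := integrableOn_rpow_mul_exp_neg_mul_rpow (p := 1) (s := a - 1) (b := ρ) (by linarith) one_pos hρ
  refine this.congr_fun (fun t ht => ?_) measurableSet_Ioi
  simp


theorem halfplane_integral (a : ℝ) (ha : 0 < a) (z : ℂ) (hz : 0 < z.re) :
    (∫ t in Set.Ioi (0:ℝ), ((t ^ (a - 1) : ℝ) : ℂ) * Complex.exp (-z * t))
      = (1 / z) ^ (a : ℂ) * Complex.Gamma a := by
  have hopen : IsOpen {z : ℂ | 0 < z.re} := isOpen_lt continuous_const Complex.continuous_re
  have hconv : Convex ℝ {z : ℂ | 0 < z.re} := convex_halfSpace_re_gt 0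
  have hmeas : ∀ (b : ℝ) (z : ℂ), AEStronglyMeasurable
      (fun t : ℝ => ((t ^ b : ℝ) : ℂ) * Complex.exp (-z * t)) (volume.restrict (Set.Ioi 0)) := by
    intro b z
    exact Measurable.aestronglyMeasurable (by fun_prop)
  have hnorm : ∀ (b : ℝ) (z : ℂ) (t : ℝ), 0 < t →
      ‖((t ^ b : ℝ) : ℂ) * Complex.exp (-z * t)‖ = t ^ b * Real.exp (-(z.re * t)) := by
    intro b z t ht
    rw [norm_mul, Complex.norm_real, Real.norm_of_nonneg (by positivity), Complex.norm_exp]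
    simp
  have hd : DifferentiableOn ℂ (fun z : ℂ => ∫ t in Set.Ioi (0:ℝ),
      ((t ^ (a - 1) : ℝ) : ℂ) * Complex.exp (-z * t)) {z : ℂ | 0 < z.re} := by
    intro z₀ hz₀
    replace hz₀ : 0 < z₀.re := hz₀
    have hs : {z : ℂ | z₀.re / 2 < z.re} ∈ nhds z₀ :=
      (isOpen_lt continuous_const Complex.continuous_re).mem_nhds (by simp; linarith)
    have := hasDerivAt_integral_of_dominated_loc_of_deriv_le
      (μ := volume.restrict (Set.Ioi (0:ℝ)))
      (F := fun (z : ℂ) (t : ℝ) => ((t ^ (a - 1) : ℝ) : ℂ) * Complex.exp (-z * t))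
      (F' := fun (z : ℂ) (t : ℝ) => ((t ^ (a - 1) : ℝ) : ℂ) * (Complex.exp (-z * t) * (-t)))
      (bound := fun t : ℝ => t ^ (a + 1 - 1) * Real.exp (-(z₀.re / 2 * t)))
      (x₀ := z₀) hs (Filter.Eventually.of_forall fun z => hmeas (a - 1) z) ?_ ?_ ?_ ?_ ?_
    · exact this.2.differentiableAt.differentiableWithinAt
    · refine (real_integrable z₀.re a hz₀ ha).mono' (hmeas _ _) ?_
      filter_upwards [ae_restrict_mem measurableSet_Ioi] with t ht
      exact (hnorm _ _ _ ht).le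
    · exact Measurable.aestronglyMeasurable (by fun_prop)
    · filter_upwards [ae_restrict_mem measurableSet_Ioi] with t ht z hz
      simp only [Set.mem_Ioi] at ht
      replace hz : z₀.re / 2 < z.re := hz
      rw [← mul_assoc, norm_mul, hnorm _ _ _ ht, norm_neg, Complex.norm_real,
        Real.norm_of_nonneg ht.le, mul_right_comm, ← Real.rpow_add_one ht.ne']
      have : a - 1 + 1 = a + 1 - 1 := by ring
      rw [this]
      gcongr
    · exact real_integrable _ _ (by linarith) (by linarith)
    · filter_upwards with t z hz
      refine HasDerivAt.const_mul _ ?_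
      have h1 : HasDerivAt (fun z : ℂ => -z * (t:ℂ)) (-(t:ℂ)) z := by
        simpa using ((hasDerivAt_id z).neg.mul_const (t:ℂ))
      exact h1.cexp
  have hg : DifferentiableOn ℂ (fun z : ℂ => (1 / z) ^ (a : ℂ) * Complex.Gamma a)
      {z : ℂ | 0 < z.re} := by
    intro z hz
    replace hz : 0 < z.re := hz
    have hz0 : z ≠ 0 := by rintro rfl; simp at hz
    refine DifferentiableAt.differentiableWithinAt ?_
    refine DifferentiableAt.mul_const ?_ _
    refine DifferentiableAt.cpow_const ?_ ?_
    · exact (differentiableAt_const _).div differentiableAt_id hz0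
    · left
      rw [one_div, Complex.inv_re]
      exact div_pos hz (Complex.normSq_pos.2 hz0)
  refine (hd.analyticOnNhd hopen).eqOn_of_preconnected_of_frequently_eq (hg.analyticOnNhd hopen)
    hconv.isPreconnected (z₀ := 1) (by simp) ?_ hz
  have htend : Filter.Tendsto (fun n : ℕ => ((1 + 1 / ((n:ℝ) + 1) : ℝ) : ℂ)) Filter.atTop
      (nhdsWithin 1 {1}ᶜ) := by
    refine tendsto_nhdsWithin_iff.2 ⟨?_, Filter.Eventually.of_forall fun n => ?_⟩
    · have := (tendsto_one_div_add_atTop_nhds_zero_nat (𝕜 := ℝ)).const_add 1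
      rw [add_zero] at this
      exact (Complex.continuous_ofReal.tendsto' 1 1 (by simp)).comp this
    · have : (0:ℝ) < 1 / ((n:ℝ) + 1) := by positivity
      simp only [Set.mem_compl_iff, Set.mem_singleton_iff]
      intro h
      have := Complex.ofReal_injective (h.trans Complex.ofReal_one.symm)
      linarith
  refine htend.frequently (Filter.Frequently.of_forall fun n => ?_)
  have hr : (0:ℝ) < 1 + 1 / ((n:ℝ) + 1) := by positivity
  rw [← Complex.integral_cpow_mul_exp_neg_mul_Ioi (by simpa using ha) hr]
  refine setIntegral_congr_fun measurableSet_Ioi fun t ht => ?_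
  simp only [Set.mem_Ioi] at ht
  rw [Complex.ofReal_cpow ht.le]
  push_cast
  ring_nf

/-- Complex Gamma integral along a ray. -/
theorem ray_integral (ρ β a : ℝ) (hρ : 0 < ρ) (hβ : |β| < Real.pi / 2) (ha : 0 < a) :
    (∫ t in Set.Ioi (0:ℝ), ((t ^ (a - 1) : ℝ) : ℂ) *
      Complex.exp (-((ρ : ℂ) * Complex.exp (β * Complex.I)) * t))
      = ((ρ ^ (-a) * Real.Gamma a : ℝ) : ℂ) * Complex.exp (-(β * a * Complex.I)) := by
  have hb := abs_lt.1 hβ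
  have hre : 0 < ((ρ : ℂ) * Complex.exp (β * Complex.I)).re := by
    rw [Complex.re_ofReal_mul, Complex.exp_ofReal_mul_I_re]
    exact mul_pos hρ (Real.cos_pos_of_mem_Ioo ⟨by linarith [hb.1], hb.2⟩)
  have h := halfplane_integral a ha ((ρ : ℂ) * Complex.exp (β * Complex.I)) hre
  have h1 : (1 / ((ρ : ℂ) * Complex.exp (β * Complex.I))) ^ (a : ℂ)
      = ((ρ ^ (-a) : ℝ) : ℂ) * Complex.exp (-(β * a * Complex.I)) := by
    have : (1 / ((ρ : ℂ) * Complex.exp (β * Complex.I)))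
        = Complex.exp (((-Real.log ρ : ℝ) : ℂ) + ((-β : ℝ) : ℂ) * Complex.I) := by
      rw [Complex.exp_add, ← Complex.ofReal_exp, Real.exp_neg, Real.exp_log hρ]
      push_cast
      rw [neg_mul, Complex.exp_neg]
      rw [one_div, mul_inv]
    rw [this, Complex.cpow_def_of_ne_zero (Complex.exp_ne_zero _), Complex.log_exp]
    · rw [Real.rpow_def_of_pos hρ, Complex.ofReal_exp, ← Complex.exp_add]
      congr 1
      push_cast
      ring
    · simp; linarith [hb.1, hb.2, Real.pi_pos]
    · simp; linarith [hb.1, hb.2, Real.pi_pos]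
  rw [h1] at h
  rw [Complex.ofReal_mul, ← Complex.Gamma_ofReal, mul_assoc, mul_comm (Complex.Gamma _), ← mul_assoc, ← h]

theorem summable_aux (α x : ℝ) (hα0 : 0 < α) (hα1 : α < 1) (hx : 0 < x) :
    Summable (fun k : ℕ => x ^ k / (k.factorial : ℝ) * Real.Gamma (k * α + 1)) := by
  have hs : Summable (fun k : ℕ => x ^ k / (k.factorial : ℝ) ^ (1 - α)) := by
    refine summable_of_ratio_test_tendsto_lt_one (l := 0) one_pos ?_ ?_
    · exact Filter.Eventually.of_forall fun k => by positivity
    · have h1 : Filter.Tendsto (fun k : ℕ => x * ((k + 1 : ℕ) : ℝ) ^ (-(1 - α))) Filter.atTop (nhds (x * 0)) := by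
        refine Filter.Tendsto.const_mul _ ?_
        have := (tendsto_rpow_neg_atTop (y := 1 - α) (by linarith)).comp
          (tendsto_natCast_atTop_atTop (R := ℝ))
        exact (Filter.tendsto_add_atTop_iff_nat 1).2 this
      rw [mul_zero] at h1
      refine h1.congr fun k => ?_
      have hk : (0:ℝ) < k.factorial := by positivity
      have hk1 : (0:ℝ) < ((k + 1 : ℕ) : ℝ) := by positivity
      rw [Real.norm_of_nonneg (by positivity), Real.norm_of_nonneg (by positivity),
        Nat.factorial_succ, Nat.cast_mul, Real.mul_rpow hk1.le hk.le, Real.rpow_neg hk1.le, pow_succ]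
      have := Real.rpow_pos_of_pos hk (1 - α)
      have := Real.rpow_pos_of_pos hk1 (1 - α)
      field_simp
  refine Summable.of_nonneg_of_le (fun k => ?_) (fun k => ?_) hs
  · have : 0 < Real.Gamma (k * α + 1) := Real.Gamma_pos_of_pos (by positivity)
    positivity
  · have h := Real.Gamma_mul_add_mul_le_rpow_Gamma_mul_rpow_Gamma (s := (k:ℝ) + 1) (t := 1)
      (a := α) (b := 1 - α) (by positivity) one_pos hα0 (by linarith) (by ring)
    rw [Real.Gamma_one, Real.one_rpow, Real.Gamma_nat_eq_factorial] at h
    have e : α * ((k:ℝ) + 1) + (1 - α) * 1 = k * α + 1 := by ring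
    rw [e, mul_one] at h
    have hk : (0:ℝ) < k.factorial := by positivity
    calc x ^ k / (k.factorial : ℝ) * Real.Gamma (k * α + 1)
        ≤ x ^ k / (k.factorial : ℝ) * (k.factorial : ℝ) ^ α := by gcongr
      _ = _ := by
        rw [Real.rpow_sub hk, Real.rpow_one]
        field_simp

noncomputable def angB (α : ℝ) : ℝ := -(α * Real.pi / 2)
noncomputable def angW (α : ℝ) : ℝ := α * (Real.pi + angB α)
/-- The kernel of the integral representation. -/
noncomputable def kerK (α θ r : ℝ) : ℂ :=
  Complex.exp (angB α * Complex.I) * Complex.exp (-Complex.exp (angB α * Complex.I) * r) *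
    Complex.exp (-(((r ^ α : ℝ) : ℂ) * Complex.exp (angW α * Complex.I)) * θ)

theorem angB_lt (α : ℝ) (hα0 : 0 < α) (hα1 : α < 1) : |angB α| < Real.pi / 2 := by
  have := Real.pi_pos
  rw [angB, abs_neg, abs_of_pos (by positivity)]
  nlinarith

theorem angW_lt (α : ℝ) (hα0 : 0 < α) (hα1 : α < 1) : |angW α| < Real.pi / 2 := by
  have hp := Real.pi_pos
  have e : angW α = Real.pi / 2 * (α * (2 - α)) := by rw [angW, angB]; ring
  have h1 : 0 < α * (2 - α) := mul_pos hα0 (by linarith)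
  have h2 : α * (2 - α) < 1 := by nlinarith [sq_pos_of_pos (sub_pos.2 hα1)]
  rw [e, abs_of_pos (by positivity)]
  nlinarith

theorem cos_pos_of_abs (β : ℝ) (h : |β| < Real.pi / 2) : 0 < Real.cos β := by
  have hb := abs_lt.1 h
  exact Real.cos_pos_of_mem_Ioo ⟨by linarith [hb.1], hb.2⟩

theorem norm_exp_ray (β t : ℝ) (ρ : ℝ) :
    ‖Complex.exp (-((ρ : ℂ) * Complex.exp (β * Complex.I)) * t)‖
      = Real.exp (-(ρ * Real.cos β * t)) := by
  rw [Complex.norm_exp]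
  congr 1
  rw [← neg_mul, mul_assoc, mul_comm (Complex.exp _) (t : ℂ), ← mul_assoc]
  rw [show (-(ρ:ℂ) * t) = ((-(ρ * t) : ℝ) : ℂ) by push_cast; ring, Complex.re_ofReal_mul,
    Complex.exp_ofReal_mul_I_re]
  ring

theorem norm_exp_ray_one (β t : ℝ) :
    ‖Complex.exp (-Complex.exp (β * Complex.I) * t)‖
      = Real.exp (-(Real.cos β * t)) := by
  have := norm_exp_ray β t 1
  simpa using this

theorem hasSum_kerK (α θ : ℝ) (hα0 : 0 < α) (hα1 : α < 1) (hθ : 0 < θ) :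
    HasSum (fun k : ℕ => (((-θ) ^ k / (k.factorial : ℝ) * Real.Gamma (k * α + 1) : ℝ) : ℂ) *
      Complex.exp (((k * Real.pi * α : ℝ) : ℂ) * Complex.I))
      (∫ r in Set.Ioi (0:ℝ), kerK α θ r) := by
  have hB := angB_lt α hα0 hα1
  have hcB := cos_pos_of_abs _ hB
  set c := Complex.exp (angB α * Complex.I) with hc
  set w := Complex.exp (angW α * Complex.I) with hw
  have hcn : ‖c‖ = 1 := Complex.norm_exp_ofReal_mul_I _
  have hwn : ‖w‖ = 1 := Complex.norm_exp_ofReal_mul_I _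
  let F : ℕ → ℝ → ℂ := fun k r =>
    (c * ((-θ * w) ^ k / (k.factorial : ℂ))) *
      (((r ^ ((k * α + 1) - 1 : ℝ) : ℝ) : ℂ) * Complex.exp (-c * r))
  have hFn : ∀ k r, 0 < r → ‖F k r‖ = θ ^ k / (k.factorial : ℝ) *
      (r ^ ((k * α + 1) - 1 : ℝ) * Real.exp (-(Real.cos (angB α) * r))) := by
    intro k r hr
    simp only [F]
    rw [norm_mul, norm_mul, norm_mul, hcn, norm_exp_ray_one, Complex.norm_real,
      Real.norm_of_nonneg (by positivity)]
    simp [hwn, abs_of_pos hθ]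
  have hFi : ∀ k, Integrable (F k) (volume.restrict (Set.Ioi 0)) := by
    intro k
    refine Integrable.mono' ((real_integrable (Real.cos (angB α)) (k * α + 1) hcB
      (by positivity)).const_mul (θ ^ k / (k.factorial : ℝ))) ?_ ?_
    · exact Measurable.aestronglyMeasurable (by simp only [F]; fun_prop)
    · filter_upwards [ae_restrict_mem measurableSet_Ioi] with r hr
      exact (hFn k r hr).le
  have hFs : Summable fun k => ∫ r in Set.Ioi (0:ℝ), ‖F k r‖ := by
    have hx : 0 < θ * (1 / Real.cos (angB α)) ^ α := by positivity
    refine ((summable_aux α _ hα0 hα1 hx).mul_left (1 / Real.cos (angB α))).congr fun k => ?_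
    rw [setIntegral_congr_fun measurableSet_Ioi (fun r hr => hFn k r hr), integral_const_mul,
      Real.integral_rpow_mul_exp_neg_mul_Ioi (by positivity) hcB,
      Real.rpow_add_one (by positivity), mul_comm (k:ℝ) α, Real.rpow_mul (by positivity),
      Real.rpow_natCast, mul_pow]
    ring
  have h := hasSum_integral_of_summable_integral_norm hFi hFs
  have e1 : (∫ r in Set.Ioi (0:ℝ), ∑' k, F k r) = ∫ r in Set.Ioi (0:ℝ), kerK α θ r := by
    refine setIntegral_congr_fun measurableSet_Ioi fun r hr => ?_
    simp only [Set.mem_Ioi] at hr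
    have : ∀ k, F k r = (c * Complex.exp (-c * r)) *
        ((-(((r ^ α : ℝ) : ℂ) * w) * θ) ^ k / (k.factorial : ℂ)) := by
      intro k
      simp only [F]
      rw [add_sub_cancel_right, mul_comm (k:ℝ) α, Real.rpow_mul hr.le, Real.rpow_natCast]
      push_cast
      rw [show (-(((r ^ α : ℝ) : ℂ) * w) * θ) = (-θ * w) * ((r ^ α : ℝ) : ℂ) by ring, mul_pow]
      ring
    simp only [this]
    have hexp : ∀ z : ℂ, ∑' k : ℕ, z ^ k / (k.factorial : ℂ) = Complex.exp z := by
      intro z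
      rw [Complex.exp_eq_exp_ℂ, NormedSpace.exp_eq_tsum_div]
    rw [tsum_mul_left, hexp, kerK]
  rw [e1] at h
  refine h.congr_fun ?_
  intro k
  have hr := ray_integral 1 (angB α) (k * α + 1) one_pos hB (by positivity)
  simp only [Complex.ofReal_one, one_mul, Real.one_rpow, ← hc] at hr
  simp only [F]
  rw [integral_const_mul, hr, hc, hw, mul_pow, ← Complex.exp_nat_mul]
  have : Complex.exp (((k * Real.pi * α : ℝ) : ℂ) * Complex.I)
     = Complex.exp (angB α * Complex.I) * Complex.exp (k * (angW α * Complex.I)) *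
       Complex.exp (-(angB α * ((k * α + 1 : ℝ) : ℂ) * Complex.I)) := by
    rw [← Complex.exp_add, ← Complex.exp_add]
    congr 1
    rw [angW]
    push_cast
    ring
  rw [this]
  push_cast
  ring

theorem zeta_series (α θ : ℝ) (hα0 : 0 < α) (hθ : 0 < θ) :
    zetaFn α θ = (1 / (α * Real.pi)) * ∑' n : ℕ, (-1 : ℝ) ^ n * θ ^ n *
      (Real.Gamma (((n : ℝ) + 1) * α + 1) / (Nat.factorial (n + 1) : ℝ)) *
      Real.sin (((n : ℝ) + 1) * Real.pi * α) := by
  have hp := Real.pi_pos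
  rw [zetaFn, wrightFn, mul_left_comm, ← mul_assoc, mul_left_comm, mul_assoc, mul_assoc,
    ← tsum_mul_left, ← mul_assoc, one_div_mul_one_div]
  congr 2
  funext n
  have : (θ ^ (-(1 / α))) ^ (-(α * ((n : ℝ) + 1)) - 1) = θ ^ n * θ ^ (1 + 1 / α) := by
    rw [← Real.rpow_mul hθ.le, ← Real.rpow_natCast θ n, ← Real.rpow_add hθ]
    congr 1
    field_simp
    ring
  have h2 : θ ^ (-1 - 1 / α) * θ ^ (1 + 1 / α) = 1 := by
    rw [← Real.rpow_add hθ]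
    ring_nf
    exact Real.rpow_zero _
  rw [this]
  linear_combination ((-1 : ℝ) ^ n * θ ^ n *
      (Real.Gamma (((n : ℝ) + 1) * α + 1) / (Nat.factorial (n + 1) : ℝ)) *
      Real.sin (((n : ℝ) + 1) * Real.pi * α)) * h2

theorem zeta_kerK (α θ : ℝ) (hα0 : 0 < α) (hα1 : α < 1) (hθ : 0 < θ) :
    zetaFn α θ = -(1 / (α * Real.pi)) * (θ⁻¹ * (∫ r in Set.Ioi (0:ℝ), kerK α θ r).im) := by
  have h := Complex.hasSum_im (hasSum_kerK α θ hα0 hα1 hθ)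
  have h' := (hasSum_nat_add_iff' 1).2 h
  simp only [Complex.im_ofReal_mul, Complex.exp_ofReal_mul_I_im, Finset.sum_range_one] at h'
  simp only [Nat.cast_zero, zero_mul, Real.sin_zero, mul_zero, sub_zero] at h'
  rw [zeta_series α θ hα0 hθ, ← h'.tsum_eq, neg_mul, ← mul_neg, ← neg_mul (θ⁻¹), ← tsum_mul_left (a := -θ⁻¹)]
  congr 2
  funext n
  rw [neg_pow θ, pow_succ θ]
  push_cast
  field_simp
  ring

theorem zeta_bound (α : ℝ) (hα0 : 0 < α) (hα1 : α < 1) :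
    ∃ C : ℝ, ∀ θ ∈ Set.Ioc (0:ℝ) 1, ‖zetaFn α θ‖ ≤ C := by
  have hs := (summable_nat_add_iff 1).2 (summable_aux α 1 hα0 hα1 one_pos)
  refine ⟨‖1 / (α * Real.pi)‖ * ∑' n : ℕ, 1 ^ (n + 1) / ((n + 1).factorial : ℝ) *
    Real.Gamma (((n + 1 : ℕ) : ℝ) * α + 1), fun θ hθ => ?_⟩
  · rw [zeta_series α θ hα0 hθ.1, norm_mul]
    refine mul_le_mul_of_nonneg_left (tsum_of_norm_bounded hs.hasSum fun n => ?_) (norm_nonneg _)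
    have hG : 0 < Real.Gamma (((n : ℝ) + 1) * α + 1) := Real.Gamma_pos_of_pos (by positivity)
    simp only [norm_mul, norm_pow, norm_neg, norm_one, one_pow, one_mul, norm_div]
    rw [Real.norm_of_nonneg hG.le, Real.norm_of_nonneg hθ.1.le, Real.norm_of_nonneg (Nat.cast_nonneg _)]
    have h1 : θ ^ n ≤ 1 := pow_le_one₀ hθ.1.le hθ.2
    have h2 : ‖Real.sin (((n : ℝ) + 1) * Real.pi * α)‖ ≤ 1 := Real.abs_sin_le_one _
    push_cast
    have hX : 0 ≤ Real.Gamma (((n : ℝ) + 1) * α + 1) / (Nat.factorial (n + 1) : ℝ) := by positivity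
    calc _ ≤ 1 * (Real.Gamma (((n : ℝ) + 1) * α + 1) / (Nat.factorial (n + 1) : ℝ)) * 1 := by
          gcongr
      _ = _ := by ring

/-- Fubini data. -/
theorem kerK_integrable (α v : ℝ) (hα0 : 0 < α) (hα1 : α < 1) (hv0 : 0 < v) (hv1 : v ≤ 1) :
    Integrable (Function.uncurry fun (θ r : ℝ) => ((θ ^ (v - 1) : ℝ) : ℂ) * kerK α θ r)
      ((volume.restrict (Set.Ioi 0)).prod (volume.restrict (Set.Ioi 0))) := by
  have hcB := cos_pos_of_abs _ (angB_lt α hα0 hα1)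
  have hcW := cos_pos_of_abs _ (angW_lt α hα0 hα1)
  have hm : AEStronglyMeasurable
      (Function.uncurry fun (θ r : ℝ) => ((θ ^ (v - 1) : ℝ) : ℂ) * kerK α θ r)
      ((volume.restrict (Set.Ioi (0:ℝ))).prod (volume.restrict (Set.Ioi (0:ℝ)))) := by
    refine Measurable.aestronglyMeasurable ?_
    simp only [Function.uncurry_def, kerK]
    fun_prop
  have hn : ∀ θ r : ℝ, 0 < θ → 0 < r → ‖((θ ^ (v - 1) : ℝ) : ℂ) * kerK α θ r‖ =
      Real.exp (-(Real.cos (angB α) * r)) *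
        (θ ^ (v - 1) * Real.exp (-((r ^ α * Real.cos (angW α)) * θ))) := by
    intro θ r hθ hr
    rw [kerK, norm_mul, norm_mul, norm_mul, norm_exp_ray_one, norm_exp_ray,
      Complex.norm_exp_ofReal_mul_I, Complex.norm_real, Real.norm_of_nonneg (by positivity)]
    ring
  rw [integrable_prod_iff' hm]
  constructor
  · filter_upwards [ae_restrict_mem measurableSet_Ioi] with r hr
    simp only [Set.mem_Ioi] at hr
    refine Integrable.mono' ((real_integrable (r ^ α * Real.cos (angW α)) v (by positivity)
      hv0).const_mul (Real.exp (-(Real.cos (angB α) * r)))) ?_ ?_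
    · refine Measurable.aestronglyMeasurable ?_
      simp only [Function.uncurry_def, kerK]
      fun_prop
    · filter_upwards [ae_restrict_mem measurableSet_Ioi] with θ hθ
      exact (hn θ r hθ hr).le
  · have hi := (real_integrable (Real.cos (angB α)) (1 - α * v) hcB (by nlinarith)).const_mul
      ((1 / Real.cos (angW α)) ^ v * Real.Gamma v)
    refine hi.congr ?_
    filter_upwards [ae_restrict_mem measurableSet_Ioi] with r hr
    simp only [Set.mem_Ioi] at hr
    simp only [Function.uncurry_apply_pair]
    rw [setIntegral_congr_fun measurableSet_Ioi (fun θ hθ => hn θ r hθ hr), integral_const_mul,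
      Real.integral_rpow_mul_exp_neg_mul_Ioi hv0 (by positivity)]
    rw [← one_div_mul_one_div, Real.mul_rpow (by positivity) (by positivity), one_div (r ^ α),
      ← Real.rpow_neg hr.le, ← Real.rpow_mul hr.le]
    rw [show 1 - α * v - 1 = -α * v by ring]
    ring

theorem kerK_moment (α v : ℝ) (hα0 : 0 < α) (hα1 : α < 1) (hv0 : 0 < v) (hv1 : v ≤ 1) :
    (∫ θ in Set.Ioi (0:ℝ), ((θ ^ (v - 1) : ℝ) : ℂ) * ∫ r in Set.Ioi (0:ℝ), kerK α θ r)
      = ((Real.Gamma v * Real.Gamma (1 - α * v) : ℝ) : ℂ) *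
        Complex.exp (((-(Real.pi * (α * v)) : ℝ) : ℂ) * Complex.I) := by
  have hs := integral_integral_swap (kerK_integrable α v hα0 hα1 hv0 hv1)
  simp only [integral_const_mul] at hs
  rw [hs]
  have h1 : ∀ r ∈ Set.Ioi (0:ℝ), (∫ θ in Set.Ioi (0:ℝ), ((θ ^ (v - 1) : ℝ) : ℂ) * kerK α θ r)
      = (Complex.exp (angB α * Complex.I) * ((Real.Gamma v : ℝ) : ℂ) *
          Complex.exp (-(angW α * v * Complex.I))) *
        (((r ^ ((1 - α * v) - 1) : ℝ) : ℂ) *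
          Complex.exp (-(((1:ℝ):ℂ) * Complex.exp (angB α * Complex.I)) * r)) := by
    intro r hr
    simp only [Set.mem_Ioi] at hr
    have h := ray_integral (r ^ α) (angW α) v (by positivity) (angW_lt α hα0 hα1) hv0
    simp only [kerK]
    simp_rw [mul_left_comm ((_ : ℝ) : ℂ) (_ * _) (Complex.exp _)]
    rw [integral_const_mul, h, ← Real.rpow_mul hr.le, show 1 - α * v - 1 = α * -v by ring]
    push_cast
    ring_nf
  rw [setIntegral_congr_fun measurableSet_Ioi h1, integral_const_mul,
    ray_integral 1 (angB α) (1 - α * v) one_pos (angB_lt α hα0 hα1) (by nlinarith)]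
  have : Complex.exp (((-(Real.pi * (α * v)) : ℝ) : ℂ) * Complex.I)
     = Complex.exp (angB α * Complex.I) * Complex.exp (-(angW α * v * Complex.I)) *
       Complex.exp (-(angB α * ((1 - α * v : ℝ) : ℂ) * Complex.I)) := by
    rw [← Complex.exp_add, ← Complex.exp_add]
    congr 1
    rw [angW]
    push_cast
    ring
  rw [this, Real.one_rpow]
  push_cast
  ring

theorem zeta_moment_pos (α v : ℝ) (hα0 : 0 < α) (hα1 : α < 1) (hv0 : 0 < v) (hv1 : v ≤ 1) :
    IntegrableOn (fun θ : ℝ => θ ^ v * zetaFn α θ) (Set.Ioi 0) ∧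
    (∫ θ in Set.Ioi (0 : ℝ), θ ^ v * zetaFn α θ)
      = Real.Gamma (1 + v) / Real.Gamma (1 + α * v) := by
  have hI := (kerK_integrable α v hα0 hα1 hv0 hv1).integral_prod_left
  simp only [Function.uncurry_apply_pair, integral_const_mul] at hI
  have hcongr : ∀ θ ∈ Set.Ioi (0:ℝ), -(1 / (α * Real.pi)) *
      Complex.imCLM (((θ ^ (v - 1) : ℝ) : ℂ) * ∫ r in Set.Ioi (0:ℝ), kerK α θ r)
      = θ ^ v * zetaFn α θ := by
    intro θ hθ
    simp only [Set.mem_Ioi] at hθ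
    rw [zeta_kerK α θ hα0 hα1 hθ, Complex.imCLM_apply, Complex.im_ofReal_mul,
      Real.rpow_sub_one hθ.ne']
    ring
  constructor
  · have h2 := (Complex.imCLM.integrable_comp hI).const_mul (-(1 / (α * Real.pi)))
    exact IntegrableOn.congr_fun h2 hcongr measurableSet_Ioi
  · rw [← setIntegral_congr_fun measurableSet_Ioi hcongr, integral_const_mul,
      Complex.imCLM.integral_comp_comm hI, kerK_moment α v hα0 hα1 hv0 hv1, Complex.imCLM_apply,
      Complex.im_ofReal_mul, Complex.exp_ofReal_mul_I_im, Real.sin_neg]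
    have hav : 0 < α * v := by positivity
    have hav1 : α * v < 1 := by nlinarith
    have hr := Real.Gamma_mul_Gamma_one_sub (α * v)
    have hsin : 0 < Real.sin (Real.pi * (α * v)) :=
      Real.sin_pos_of_pos_of_lt_pi (by positivity) (by nlinarith [Real.pi_pos])
    have hG := Real.Gamma_pos_of_pos hav
    have hp := Real.pi_pos
    rw [add_comm 1 v, add_comm 1 (α * v), Real.Gamma_add_one hv0.ne', Real.Gamma_add_one hav.ne']
    have : Real.Gamma (1 - α * v) = Real.pi / Real.sin (Real.pi * (α * v)) / Real.Gamma (α * v) := by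
      rw [← hr]; field_simp
    rw [this]
    generalize Real.sin (Real.pi * (α * v)) = S at hsin
    field_simp

theorem zeta_moment (α v : ℝ) (hα0 : 0 < α) (hα1 : α < 1) (hv0 : 0 ≤ v) (hv1 : v ≤ 1) :
    (∫ θ in Set.Ioi (0 : ℝ), θ ^ v * zetaFn α θ)
      = Real.Gamma (1 + v) / Real.Gamma (1 + α * v) := by
  rcases hv0.eq_or_lt with rfl | hv0
  swap
  · exact (zeta_moment_pos α v hα0 hα1 hv0 hv1).2
  have h1 := (zeta_moment_pos α 1 hα0 hα1 one_pos le_rfl).1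
  simp only [Real.rpow_one] at h1
  obtain ⟨C, hC⟩ := zeta_bound α hα0 hα1
  have hC0 : 0 ≤ C := (norm_nonneg _).trans (hC 1 ⟨one_pos, le_rfl⟩)
  have hind : Integrable ((Set.Ioc (0:ℝ) 1).indicator fun _ => C)
      (volume.restrict (Set.Ioi 0)) := by
    refine Integrable.integrableOn ?_
    rw [integrable_indicator_iff measurableSet_Ioc]
    simp
  let vn : ℕ → ℝ := fun n => 1 / ((n:ℝ) + 1)
  have hvn0 : ∀ n, 0 < vn n := fun n => by simp only [vn]; positivity
  have hvn1 : ∀ n, vn n ≤ 1 := fun n => by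
    simp only [vn]
    rw [div_le_one (by positivity)]
    linarith [(Nat.cast_nonneg n : (0:ℝ) ≤ n)]
  have hvt : Filter.Tendsto vn Filter.atTop (nhds 0) := tendsto_one_div_add_atTop_nhds_zero_nat
  have hlim := tendsto_integral_of_dominated_convergence (μ := volume.restrict (Set.Ioi (0:ℝ)))
    (F := fun n θ => θ ^ vn n * zetaFn α θ) (f := fun θ => θ ^ (0:ℝ) * zetaFn α θ)
    (fun θ => (Set.Ioc (0:ℝ) 1).indicator (fun _ => C) θ + ‖θ * zetaFn α θ‖)
    (fun n => (zeta_moment_pos α _ hα0 hα1 (hvn0 n) (hvn1 n)).1.1) (hind.add h1.norm) ?_ ?_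
  · have e : ∀ n, (∫ θ in Set.Ioi (0:ℝ), θ ^ vn n * zetaFn α θ)
        = Real.Gamma (1 + vn n) / Real.Gamma (1 + α * vn n) := fun n =>
      (zeta_moment_pos α _ hα0 hα1 (hvn0 n) (hvn1 n)).2
    simp only [e] at hlim
    refine tendsto_nhds_unique hlim ?_
    have hc : ∀ b : ℝ, Filter.Tendsto (fun n => Real.Gamma (1 + b * vn n)) Filter.atTop
        (nhds (Real.Gamma (1 + b * 0))) := by
      intro b
      have hd : ContinuousAt Real.Gamma (1 + b * 0) := by
        refine (Real.differentiableAt_Gamma fun m => ?_).continuousAt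
        have : (0:ℝ) ≤ m := Nat.cast_nonneg m
        intro h
        linarith
      exact hd.tendsto.comp ((hvt.const_mul b).const_add 1)
    have := (hc 1).div (hc α) (by simp)
    simp only [one_mul] at this
    simp only [mul_zero, add_zero] at this ⊢
    exact this
  · intro n
    filter_upwards [ae_restrict_mem measurableSet_Ioi] with θ hθ
    simp only [Set.mem_Ioi] at hθ
    rw [norm_mul, norm_mul, Real.norm_of_nonneg (by positivity), Real.norm_of_nonneg hθ.le]
    by_cases h : θ ≤ 1
    · have hmem : θ ∈ Set.Ioc (0:ℝ) 1 := ⟨hθ, h⟩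
      rw [Set.indicator_of_mem hmem]
      have a1 : θ ^ vn n ≤ 1 := Real.rpow_le_one hθ.le h (hvn0 n).le
      have a2 := hC θ ⟨hθ, h⟩
      have a3 : 0 ≤ θ * ‖zetaFn α θ‖ := by positivity
      nlinarith [norm_nonneg (zetaFn α θ)]
    · rw [Set.indicator_of_notMem (fun hh => h hh.2), zero_add]
      push Not at h
      have : θ ^ vn n ≤ θ ^ (1:ℝ) := Real.rpow_le_rpow_of_exponent_le h.le (hvn1 n)
      rw [Real.rpow_one] at this
      gcongr
  · filter_upwards [ae_restrict_mem measurableSet_Ioi] with θ hθ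
    simp only [Set.mem_Ioi] at hθ
    refine Filter.Tendsto.mul_const _ ?_
    exact ((Real.continuousAt_const_rpow hθ.ne').tendsto).comp hvt

theorem zetaFn_moment_formula (α v : ℝ) (hα0 : 0 < α) (hα1 : α < 1)
    (hv0 : 0 ≤ v) (hv1 : v ≤ 1) :
    (∫ θ in Set.Ioi (0 : ℝ), θ ^ v * zetaFn α θ)
      = Real.Gamma (1 + v) / Real.Gamma (1 + α * v) ∧
    (∫ θ in Set.Ioi (0 : ℝ), θ ^ (-(α * v)) * wrightFn α θ)
      = Real.Gamma (1 + v) / Real.Gamma (1 + α * v) := by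
  have h := zeta_moment α v hα0 hα1 hv0 hv1
  refine ⟨h, ?_⟩
  rw [← h, ← integral_comp_rpow_Ioi (fun θ : ℝ => θ ^ (-(α * v)) * wrightFn α θ)
    (p := -(1 / α)) (neg_ne_zero.2 (by positivity))]
  refine setIntegral_congr_fun measurableSet_Ioi fun θ hθ => ?_
  simp only [Set.mem_Ioi] at hθ
  simp only [smul_eq_mul]
  rw [zetaFn, abs_neg, abs_of_pos (by positivity), ← Real.rpow_mul hθ.le,
    show -(1 / α) * -(α * v) = v by field_simp, show -(1 / α) - 1 = -1 - 1 / α by ring]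
  ring
end

section
/- Let γ be a real number with −1/2 < γ < 0 and fix t₁ > 0. Then ∫₀^{t₁} ((t₁−s)^γ − (t₂−s)^γ)² ds → 0 as t₂ → t₁ from the right. In particular, this holds for γ = α−1 with 1/2 < α < 1 and for γ = −qα with 0 < qα < 1/2. -/
open MeasureTheory

theorem square_integral_of_kernel_difference_tendsto_zero (γ t₁ : ℝ)
    (hγ1 : -(1/2) < γ) (hγ2 : γ < 0) (ht : 0 < t₁) :
    Filter.Tendsto
      (fun t₂ : ℝ => ∫ s in (0:ℝ)..t₁, ((t₁ - s) ^ γ - (t₂ - s) ^ γ) ^ 2)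
      (nhdsWithin t₁ (Set.Ioi t₁)) (nhds 0) := by
  have hne : ∀ᵐ x : ℝ, x ≠ t₁ := by
    simp [ae_iff, measure_singleton]
  have key := intervalIntegral.tendsto_integral_filter_of_dominated_convergence
    (μ := volume) (a := 0) (b := t₁) (l := nhdsWithin t₁ (Set.Ioi t₁))
    (F := fun t₂ s : ℝ => ((t₁ - s) ^ γ - (t₂ - s) ^ γ) ^ 2) (f := fun _ => (0 : ℝ))
    (fun s => (t₁ - s) ^ (2 * γ)) ?_ ?_ ?_ ?_
  · simpa using key
  · refine Filter.Eventually.of_forall fun t₂ => Measurable.aestronglyMeasurable ?_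
    fun_prop
  · filter_upwards [self_mem_nhdsWithin] with t₂ h₂
    filter_upwards [hne] with s hs hmem
    rw [Set.uIoc_of_le ht.le] at hmem
    have h1 : 0 < t₁ - s := sub_pos.2 (lt_of_le_of_ne hmem.2 hs)
    have h2 : t₁ - s ≤ t₂ - s := by
      have : t₁ < t₂ := h₂
      linarith
    have h3 : (t₂ - s) ^ γ ≤ (t₁ - s) ^ γ := Real.rpow_le_rpow_of_nonpos h1 h2 hγ2.le
    have h4 : 0 ≤ (t₂ - s) ^ γ := Real.rpow_nonneg (h1.le.trans h2) _
    have h5 : (t₁ - s) ^ (2 * γ) = ((t₁ - s) ^ γ) ^ 2 := by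
      rw [mul_comm, Real.rpow_mul h1.le]
      norm_num
    rw [h5, Real.norm_of_nonneg (sq_nonneg _)]
    exact pow_le_pow_left₀ (by linarith) (by linarith) 2
  · have h := (intervalIntegral.intervalIntegrable_rpow' (a := t₁) (b := 0)
      (r := 2 * γ) (by linarith)).comp_sub_left t₁
    simpa using h
  · filter_upwards [hne] with s hs _
    have h1 : t₁ - s ≠ 0 := sub_ne_zero.2 hs.symm
    have hc : ContinuousAt (fun t₂ : ℝ => ((t₁ - s) ^ γ - (t₂ - s) ^ γ) ^ 2) t₁ := by
      refine ContinuousAt.pow (continuousAt_const.sub ?_) 2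
      exact ContinuousAt.rpow_const (by fun_prop) (Or.inl h1)
    have := hc.tendsto.mono_left (nhdsWithin_le_nhds (s := Set.Ioi t₁))
    simpa using this
end
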